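/- arXiv:2005.12107 — 3 statements merged into one kernel-verified Lean document; each statement's English description precedes it below -/
import Mathlib

section
/- Let θ be a real number and let G be a finite connected simple graph in which every vertex is θ-essential (i.e., G is θ-critical). Then the multiplicity of θ as a root of the matching polynomial of G equals 1; in particular θ is a simple root of μ(G,z). -/
open Polynomial

/-- The matching polynomial of a finite simple graph `G`:
`μ(G,z) = ∑_k (-1)^k p(k,G) z^(n-2k)`, written as a sum over all matchings
(finsets of pairwise disjoint edges). -/
noncomputable def matchingPolynomial {V : Type*} [Finite V] (G : SimpleGraph V) :
    Polynomial ℝ := by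
  classical
  have : Fintype V := Fintype.ofFinite V
  exact ∑ M ∈ Finset.univ.filter
      (fun M : Finset (Sym2 V) =>
        (∀ e ∈ M, e ∈ G.edgeSet) ∧ ∀ e ∈ M, ∀ f ∈ M, e ≠ f → ∀ v, v ∈ e → v ∉ f),
    (-1 : Polynomial ℝ) ^ M.card * X ^ (Nat.card V - 2 * M.card)

/-- `matchMult θ G` is the multiplicity of `θ` as a root of the matching polynomial
of `G` (equal to `0` if `θ` is not a root). -/
noncomputable def matchMult {V : Type*} [Finite V] (θ : ℝ) (G : SimpleGraph V) : ℕ :=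
  Polynomial.rootMultiplicity θ (matchingPolynomial G)

/-- A vertex `u` is `θ`-essential if `mult(θ, G-u) = mult(θ, G) - 1`. -/
def IsEssential {V : Type*} [Finite V] (θ : ℝ) (G : SimpleGraph V) (u : V) : Prop :=
  matchMult θ (G.induce {v | v ≠ u}) + 1 = matchMult θ G

/-- A vertex `u` is `θ`-positive if `mult(θ, G-u) = mult(θ, G) + 1`. -/
def IsPositive {V : Type*} [Finite V] (θ : ℝ) (G : SimpleGraph V) (u : V) : Prop :=
  matchMult θ (G.induce {v | v ≠ u}) = matchMult θ G + 1

/-- A vertex `u` is `θ`-neutral if `mult(θ, G-u) = mult(θ, G)`. -/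
def IsNeutral {V : Type*} [Finite V] (θ : ℝ) (G : SimpleGraph V) (u : V) : Prop :=
  matchMult θ (G.induce {v | v ≠ u}) = matchMult θ G

/-- A vertex is `θ`-special if it is not `θ`-essential but has a `θ`-essential neighbor. -/
def IsSpecial {V : Type*} [Finite V] (θ : ℝ) (G : SimpleGraph V) (u : V) : Prop :=
  ¬ IsEssential θ G u ∧ ∃ w, G.Adj u w ∧ IsEssential θ G w

/-- The outer vertex boundary `∂S`: vertices not in `S` with a neighbor in `S`. -/
def vertexBoundary {V : Type*} (G : SimpleGraph V) (S : Set V) : Set V :=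
  {v | v ∉ S ∧ ∃ w ∈ S, G.Adj v w}


namespace GallaiTheta

open Finset

open Classical in
/-- Matchings of `G` inside the vertex set `S`. -/
noncomputable def Mts {V : Type*} [Fintype V] (G : SimpleGraph V) (S : Finset V) :
    Finset (Finset (Sym2 V)) :=
  Finset.univ.filter (fun M : Finset (Sym2 V) =>
    (∀ e ∈ M, e ∈ G.edgeSet ∧ ∀ v ∈ e, v ∈ S) ∧
      ∀ e ∈ M, ∀ f ∈ M, e ≠ f → ∀ v, v ∈ e → v ∉ f)

open Classical in
/-- Weighted matching polynomial of the subgraph induced on `S`. -/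
noncomputable def F {V : Type*} [Fintype V] {R : Type*} [CommRing R] (G : SimpleGraph V)
    (x : V → R) (S : Finset V) : R :=
  ∑ M ∈ Mts G S, (-1 : R) ^ M.card * ∏ v ∈ S.filter (fun v => ∀ e ∈ M, v ∉ e), x v

lemma mem_Mts {V : Type*} [Fintype V] {G : SimpleGraph V} {S : Finset V}
    {M : Finset (Sym2 V)} : M ∈ Mts G S ↔ (∀ e ∈ M, e ∈ G.edgeSet ∧ ∀ v ∈ e, v ∈ S) ∧
      ∀ e ∈ M, ∀ f ∈ M, e ≠ f → ∀ v, v ∈ e → v ∉ f := by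
  simp [Mts]

open Classical in
lemma F_congr {V : Type*} [Fintype V] {R : Type*} [CommRing R] (G : SimpleGraph V)
    (x y : V → R) (S : Finset V) (h : ∀ v ∈ S, x v = y v) : F G x S = F G y S := by
  unfold F
  refine Finset.sum_congr rfl fun M _ => ?_
  congr 1
  refine Finset.prod_congr rfl fun v hv => h v (Finset.mem_filter.1 hv).1

lemma F_empty {V : Type*} [Fintype V] {R : Type*} [CommRing R] (G : SimpleGraph V)
    (x : V → R) : F G x ∅ = 1 := by
  classical
  have : Mts G (∅ : Finset V) = {∅} := by
    ext M
    rw [mem_Mts]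
    constructor
    · rintro ⟨h, -⟩
      rw [Finset.mem_singleton, Finset.eq_empty_iff_forall_notMem]
      intro e he
      induction e using Sym2.ind with
      | _ a b => simpa using (h _ he).2 a
    · intro h
      simp at h
      simp [h]
  simp [F, this]

open Classical in
lemma F_rec {V : Type*} [Fintype V] {R : Type*} [CommRing R] (G : SimpleGraph V)
    (x : V → R) (S : Finset V) (u : V) (hu : u ∈ S) :
    F G x S = x u * F G x (S.erase u) -
      ∑ w ∈ (S.erase u).filter (fun w => G.Adj u w), F G x ((S.erase u).erase w) := by
  set g : Finset (Sym2 V) → R := fun M =>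
    (-1 : R) ^ M.card * ∏ v ∈ S.filter (fun v => ∀ e ∈ M, v ∉ e), x v with hg
  have h0 : F G x S = ∑ M ∈ Mts G S, g M := rfl
  rw [h0, ← Finset.sum_filter_add_sum_filter_not (Mts G S) (fun M => ∀ e ∈ M, u ∉ e),
    sub_eq_add_neg]
  congr 1
  · have h1 : (Mts G S).filter (fun M => ∀ e ∈ M, u ∉ e) = Mts G (S.erase u) := by
      ext M
      simp only [Finset.mem_filter, mem_Mts, Finset.mem_erase]
      constructor
      · rintro ⟨⟨h1, h2⟩, h3⟩
        exact ⟨fun e he => ⟨(h1 e he).1, fun v hv =>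
          ⟨fun hvu => h3 e he (hvu ▸ hv), (h1 e he).2 v hv⟩⟩, h2⟩
      · rintro ⟨h1, h2⟩
        exact ⟨⟨fun e he => ⟨(h1 e he).1, fun v hv => ((h1 e he).2 v hv).2⟩, h2⟩,
          fun e he hue => ((h1 e he).2 u hue).1 rfl⟩
    rw [h1, F, Finset.mul_sum]
    refine Finset.sum_congr rfl fun M hM => ?_
    have h2 : S.filter (fun v => ∀ e ∈ M, v ∉ e) =
        insert u ((S.erase u).filter (fun v => ∀ e ∈ M, v ∉ e)) := by
      rw [← h1, Finset.mem_filter] at hM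
      ext v
      simp only [Finset.mem_filter, Finset.mem_insert, Finset.mem_erase]
      by_cases hvu : v = u
      · subst hvu; simp [hu]; exact hM.2
      · simp [hvu]
    simp only [hg]
    rw [h2, Finset.prod_insert (by simp)]
    ring
  · have h1 : (Mts G S).filter (fun M => ¬ ∀ e ∈ M, u ∉ e) =
        ((S.erase u).filter (fun w => G.Adj u w)).biUnion
          (fun w => (Mts G S).filter (fun M => s(u, w) ∈ M)) := by
      ext M
      simp only [Finset.mem_filter, Finset.mem_biUnion, Finset.mem_erase]
      constructor
      · rintro ⟨hM, h⟩
        push Not at h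
        obtain ⟨e, he, hue⟩ := h
        obtain ⟨w, rfl⟩ := hue
        have hh := (mem_Mts.1 hM).1 _ he
        have hadj : G.Adj u w := hh.1
        exact ⟨w, ⟨⟨hadj.ne', hh.2 w (by simp)⟩, hadj⟩, hM, he⟩
      · rintro ⟨w, _, hM, h⟩
        exact ⟨hM, fun h' => h' _ h (by simp)⟩
    rw [h1, Finset.sum_biUnion, ← Finset.sum_neg_distrib]
    · refine Finset.sum_congr rfl fun w hw => ?_
      simp only [Finset.mem_filter, Finset.mem_erase] at hw
      obtain ⟨⟨hwu, hwS⟩, hadj⟩ := hw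
      rw [F, ← Finset.sum_neg_distrib]
      have hnot : ∀ M ∈ Mts G ((S.erase u).erase w), s(u, w) ∉ M := by
        intro M hM h
        have := ((mem_Mts.1 hM).1 _ h).2 u (by simp)
        simp at this
      refine Finset.sum_bij' (fun M _ => M.erase s(u, w)) (fun M _ => insert s(u, w) M)
        ?_ ?_ ?_ ?_ ?_
      · intro M hM
        rw [Finset.mem_filter, mem_Mts] at hM
        obtain ⟨⟨h1, h2⟩, h3⟩ := hM
        rw [mem_Mts]
        refine ⟨fun e he => ?_, fun e he f hf => h2 e (Finset.mem_of_mem_erase he) f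
          (Finset.mem_of_mem_erase hf)⟩
        rw [Finset.mem_erase] at he
        refine ⟨(h1 e he.2).1, fun v hv => ?_⟩
        have hd := h2 e he.2 _ h3 he.1 v hv
        simp only [Sym2.mem_iff, not_or] at hd
        simp [hd.1, hd.2, (h1 e he.2).2 v hv]
      · intro M hM
        rw [mem_Mts] at hM
        obtain ⟨h1, h2⟩ := hM
        rw [Finset.mem_filter, mem_Mts]
        have hdis : ∀ e ∈ M, ∀ v, v ∈ e → v ∉ s(u, w) := by
          intro e he v hv
          have := (h1 e he).2 v hv
          simp only [Finset.mem_erase] at this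
          simp only [Sym2.mem_iff, not_or]
          exact ⟨this.2.1, this.1⟩
        refine ⟨⟨fun e he => ?_, fun e he f hf hef v hve => ?_⟩, by simp⟩
        · rcases Finset.mem_insert.1 he with rfl | he
          · refine ⟨hadj, fun v hv => ?_⟩
            rcases Sym2.mem_iff.1 hv with rfl | rfl <;> assumption
          · refine ⟨(h1 e he).1, fun v hv => ?_⟩
            have := (h1 e he).2 v hv
            simp only [Finset.mem_erase] at this
            exact this.2.2
        · rcases Finset.mem_insert.1 he with rfl | he
          · rcases Finset.mem_insert.1 hf with rfl | hf
            · exact absurd rfl hef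
            · exact fun hvf => hdis f hf v hvf hve
          · rcases Finset.mem_insert.1 hf with rfl | hf
            · exact hdis e he v hve
            · exact h2 e he f hf hef v hve
      · intro M hM
        rw [Finset.mem_filter] at hM
        exact Finset.insert_erase hM.2
      · intro M hM
        exact Finset.erase_insert (hnot M hM)
      · intro M hM
        rw [Finset.mem_filter] at hM
        have hc : M.card = (M.erase s(u, w)).card + 1 := (Finset.card_erase_add_one hM.2).symm
        have hf : S.filter (fun v => ∀ e ∈ M, v ∉ e) =
          ((S.erase u).erase w).filter (fun v => ∀ e ∈ M.erase s(u, w), v ∉ e) := by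
          ext v
          simp only [Finset.mem_filter, Finset.mem_erase]
          constructor
          · rintro ⟨hv, h⟩
            have := h _ hM.2
            simp only [Sym2.mem_iff, not_or] at this
            exact ⟨⟨this.2, this.1, hv⟩, fun e he => h e he.2⟩
          · rintro ⟨⟨h1, h2, h3⟩, h⟩
            refine ⟨h3, fun e he => ?_⟩
            by_cases hee : e = s(u, w)
            · subst hee; simp [h1, h2]
            · exact h e ⟨hee, he⟩
        simp only [hg]
        rw [hf, hc, pow_succ]
        ring
    · intro a ha b hb hab
      simp only [Function.onFun]
      rw [Finset.disjoint_left]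
      intro M hMa hMb
      rw [Finset.mem_filter] at hMa hMb
      refine (mem_Mts.1 hMa.1).2 _ hMa.2 _ hMb.2 ?_ u (by simp) (by simp)
      intro h
      apply hab
      exact Sym2.congr_right.1 h

lemma F_eval {V : Type*} [Fintype V] (G : SimpleGraph V) (S : Finset V) (z : ℝ) :
    (F G (fun _ => (X : ℝ[X])) S).eval z = F G (fun _ => z) S := by
  simp [F, Polynomial.eval_finsetSum]

open Classical in
lemma F_map {V W : Type*} [Fintype V] [Fintype W] {R : Type*} [CommRing R]
    (G : SimpleGraph V) (H : SimpleGraph W) (f : H ↪g G) (c : R) (n : ℕ) :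
    ∀ T : Finset W, T.card = n →
      F H (fun _ => c) T = F G (fun _ => c) (T.map f.toEmbedding) := by
  induction n using Nat.strong_induction_on with
  | _ n ih =>
    intro T hT
    rcases T.eq_empty_or_nonempty with rfl | ⟨u, hu⟩
    · simp [F_empty]
    · have hlt : (T.erase u).card < n := hT ▸ Finset.card_erase_lt_of_mem hu
      rw [F_rec H _ T u hu, F_rec G _ (T.map f.toEmbedding) (f u)
        (Finset.mem_map_of_mem f.toEmbedding hu)]
      have he : ∀ (T : Finset W) (a : W),
          (T.map f.toEmbedding).erase (f a) = (T.erase a).map f.toEmbedding := by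
        intro T a; exact (Finset.map_erase f.toEmbedding T a).symm
      rw [he, ih _ hlt _ rfl]
      congr 1
      rw [Finset.filter_map, Finset.sum_map]
      refine Finset.sum_congr ?_ fun w hw => ?_
      · ext w; simp
      · rw [Finset.mem_filter] at hw
        rw [ih _ (lt_trans (Finset.card_erase_lt_of_mem hw.1) hlt) _ rfl]
        exact congrArg _ (he _ _).symm

lemma mp_eq {V : Type*} [Fintype V] (G : SimpleGraph V) :
    matchingPolynomial G = F G (fun _ => (X : ℝ[X])) Finset.univ := by
  classical
  unfold matchingPolynomial F
  refine Finset.sum_congr ?_ fun M hM => ?_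
  · ext M; simp [mem_Mts]
  · have hM' := mem_Mts.1 hM
    congr 1
    rw [Finset.prod_const]
    congr 1
    have h1 : (M.biUnion (fun e => Finset.univ.filter (fun v => v ∈ e))).card = 2 * M.card := by
      rw [Finset.card_biUnion, Finset.sum_const_nat (m := 2)]
      · ring
      · intro e he
        have := (hM'.1 e he).1
        induction e using Sym2.ind with
        | _ a b =>
          have hab : G.Adj a b := this
          have : Finset.univ.filter (fun v => v ∈ s(a, b)) = {a, b} := by ext; simp
          rw [this, Finset.card_pair hab.ne]
      · intro e he f hf hef
        simp only [Function.onFun]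
        rw [Finset.disjoint_left]
        intro v hv hv'
        simp only [Finset.mem_filter, Finset.mem_univ, true_and] at hv hv'
        exact hM'.2 e he f hf hef v hv hv'
    have h2 : Finset.univ.filter (fun v => ∀ e ∈ M, v ∉ e) =
        (M.biUnion (fun e => Finset.univ.filter (fun v => v ∈ e)))ᶜ := by
      ext v; simp
    rw [h2, Finset.card_compl, h1, Nat.card_eq_fintype_card]

open Classical in
lemma mp_induce {V : Type*} [Fintype V] (G : SimpleGraph V) (u : V) :
    matchingPolynomial (G.induce {v | v ≠ u}) =
      F G (fun _ => (X : ℝ[X])) (Finset.univ.erase u) := by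
  rw [mp_eq, F_map G _ (SimpleGraph.Embedding.induce {v | v ≠ u}) X _ _ rfl]
  congr 1
  ext v
  simp [SimpleGraph.Embedding.induce]

open Classical in
lemma sum_split {V : Type*} {R : Type*} [CommRing R] (p : V → Prop) (T : Finset V) (v : V)
    (hv : v ∈ T) (f : V → R) :
    ∑ w ∈ T.filter p, f w = (if p v then f v else 0) + ∑ w ∈ (T.erase v).filter p, f w := by
  rw [Finset.sum_filter, Finset.sum_filter, 
    Finset.add_sum_erase T (fun a => if p a then f a else 0) hv]

open Classical in
lemma rayleigh_id {V : Type*} [Fintype V] {R : Type*} [CommRing R] (G : SimpleGraph V)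
    (x : V → R) (S : Finset V) (u v : V) (hu : u ∈ S) (hv : v ∈ S) (huv : u ≠ v) :
    F G x (S.erase u) * F G x (S.erase v) - F G x S * F G x ((S.erase u).erase v) =
      (if G.Adj u v then F G x ((S.erase u).erase v) ^ 2 else 0) +
      ∑ w ∈ ((S.erase u).erase v).filter (fun w => G.Adj u w),
        (F G x ((S.erase u).erase w) * F G x ((S.erase u).erase v) -
          F G x (S.erase u) * F G x (((S.erase u).erase w).erase v)) := by
  have hvu : v ∈ S.erase u := Finset.mem_erase.2 ⟨huv.symm, hv⟩
  rw [F_rec G x S u hu, F_rec G x (S.erase v) u (Finset.mem_erase.2 ⟨huv, hu⟩),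
    Finset.erase_right_comm (a := v) (b := u),
    sum_split (fun w => G.Adj u w) (S.erase u) v hvu]
  rw [Finset.sum_sub_distrib, ← Finset.sum_mul, ← Finset.mul_sum]
  have : ∀ w, ((S.erase u).erase w).erase v = ((S.erase u).erase v).erase w :=
    fun w => Finset.erase_right_comm
  simp only [this]
  split_ifs <;> ring

open Classical in
lemma rayleigh {V : Type*} [Fintype V] (G : SimpleGraph V) (x : V → ℝ) (n : ℕ) :
    ∀ (S : Finset V) (u v : V), S.card = n → u ∈ S → v ∈ S → u ≠ v →
    (if G.Adj u v then F G x ((S.erase u).erase v) ^ 2 else 0) ≤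
    F G x (S.erase u) * F G x (S.erase v) - F G x S * F G x ((S.erase u).erase v) := by
  induction n using Nat.strong_induction_on with
  | _ n ih =>
    intro S u v hS hu hv huv
    rw [rayleigh_id G x S u v hu hv huv, le_add_iff_nonneg_right]
    refine Finset.sum_nonneg fun w hw => ?_
    simp only [Finset.mem_filter, Finset.mem_erase] at hw
    refine le_trans ?_ (ih _ (hS ▸ Finset.card_erase_lt_of_mem hu) (S.erase u) w v rfl
      (Finset.mem_erase.2 ⟨hw.1.2.1, hw.1.2.2⟩) (Finset.mem_erase.2 ⟨huv.symm, hv⟩) hw.1.1)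
    split_ifs <;> positivity

open Classical in
lemma rayleigh' {V : Type*} [Fintype V] (G : SimpleGraph V) (x : V → ℝ)
    (S : Finset V) (u v : V) (hu : u ∈ S) (hv : v ∈ S) (huv : u ≠ v) :
    0 ≤ F G x (S.erase u) * F G x (S.erase v) - F G x S * F G x ((S.erase u).erase v) := by
  refine le_trans ?_ (rayleigh G x _ S u v rfl hu hv huv)
  split_ifs <;> positivity

open Classical in
lemma F_shift {V : Type*} [Fintype V] {R : Type*} [CommRing R] (G : SimpleGraph V)
    (x : V → R) (S : Finset V) (w : V) (hw : w ∈ S) (c : R) :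
    F G (Function.update x w (x w + c)) S = F G x S + c * F G x (S.erase w) := by
  have h : ∀ T : Finset V, w ∉ T → F G (Function.update x w (x w + c)) T = F G x T := by
    intro T hT
    refine F_congr _ _ _ _ fun v hv => ?_
    rw [Function.update_of_ne]
    rintro rfl; exact hT hv
  rw [F_rec G _ S w hw, F_rec G x S w hw, h _ (by simp), Function.update_self]
  rw [Finset.sum_congr rfl fun y _ => h ((S.erase w).erase y) (by simp)]
  ring

/-- The matching polynomial of the subgraph induced on `S`. -/
noncomputable def P {V : Type*} [Fintype V] (G : SimpleGraph V) (S : Finset V) : ℝ[X] :=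
  F G (fun _ => (X : ℝ[X])) S

open Classical in
lemma P_monic {V : Type*} [Fintype V] (G : SimpleGraph V) (n : ℕ) :
    ∀ S : Finset V, S.card = n → (P G S).Monic ∧ (P G S).degree = (n : WithBot ℕ) := by
  induction n using Nat.strong_induction_on with
  | _ n ih =>
    intro S hS
    rcases S.eq_empty_or_nonempty with rfl | ⟨u, hu⟩
    · simp at hS; subst hS
      simp [P, F_empty]
    · have hc := Finset.card_erase_add_one hu
      have hlt : (S.erase u).card < n := by omega
      obtain ⟨h1, h2⟩ := ih _ hlt (S.erase u) rfl
      have hrec : P G S = X * P G (S.erase u) -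
        ∑ w ∈ (S.erase u).filter (fun w => G.Adj u w), P G ((S.erase u).erase w) :=
        F_rec G _ S u hu
      have hX : (X * P G (S.erase u)).degree = (n : WithBot ℕ) := by
        rw [degree_mul, degree_X, h2, ← hS, ← hc]
        push_cast; ring
      have hd : (∑ w ∈ (S.erase u).filter (fun w => G.Adj u w),
          P G ((S.erase u).erase w)).degree < (X * P G (S.erase u)).degree := by
        rw [hX]
        refine lt_of_le_of_lt (Polynomial.degree_sum_le _ _) ?_
        refine (Finset.sup_lt_iff (WithBot.bot_lt_coe n)).2 ?_
        intro w hw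
        rw [Finset.mem_filter] at hw
        have h3 := Finset.card_erase_lt_of_mem hw.1
        rw [(ih _ (lt_trans h3 hlt) _ rfl).2]
        exact WithBot.coe_lt_coe.2 (lt_trans h3 hlt)
      rw [hrec]
      exact ⟨(monic_X.mul h1).sub_of_left hd, by rw [degree_sub_eq_left_of_degree_lt hd, hX]⟩

lemma P_ne_zero {V : Type*} [Fintype V] (G : SimpleGraph V) (S : Finset V) : P G S ≠ 0 :=
  (P_monic G _ S rfl).1.ne_zero

open Classical in
lemma P_deriv {V : Type*} [Fintype V] (G : SimpleGraph V) (n : ℕ) :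
    ∀ S : Finset V, S.card = n → derivative (P G S) = ∑ v ∈ S, P G (S.erase v) := by
  have hrec : ∀ (S : Finset V) (u : V), u ∈ S → P G S = X * P G (S.erase u) -
        ∑ w ∈ (S.erase u).filter (fun w => G.Adj u w), P G ((S.erase u).erase w) :=
    fun S u hu => F_rec G _ S u hu
  induction n using Nat.strong_induction_on with
  | _ n ih =>
    intro S hS
    rcases S.eq_empty_or_nonempty with rfl | ⟨u, hu⟩
    · simp [P, F_empty]
    · have hlt : (S.erase u).card < n := hS ▸ Finset.card_erase_lt_of_mem hu
      rw [← Finset.add_sum_erase S _ hu, hrec S u hu, derivative_sub, derivative_mul,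
        derivative_X, derivative_sum, ih _ hlt _ rfl]
      have h1 : ∀ w ∈ (S.erase u).filter (fun w => G.Adj u w),
          derivative (P G ((S.erase u).erase w)) =
            ∑ v ∈ (S.erase u).erase w, P G (((S.erase u).erase w).erase v) := by
        intro w hw
        rw [Finset.mem_filter] at hw
        exact ih _ (lt_trans (Finset.card_erase_lt_of_mem hw.1) hlt) _ rfl
      rw [Finset.sum_congr rfl h1]
      have h2 : ∀ v ∈ S.erase u, P G (S.erase v) = X * P G ((S.erase u).erase v) -
          ∑ w ∈ ((S.erase u).erase v).filter (fun w => G.Adj u w),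
            P G (((S.erase u).erase w).erase v) := by
        intro v hv
        rw [Finset.mem_erase] at hv
        rw [hrec (S.erase v) u (Finset.mem_erase.2 ⟨hv.1.symm, hu⟩),
          Finset.erase_right_comm (a := v) (b := u)]
        congr 1
        refine Finset.sum_congr rfl fun w _ => ?_
        rw [Finset.erase_right_comm (a := v) (b := w)]
      rw [Finset.sum_congr rfl h2, Finset.sum_sub_distrib, ← Finset.mul_sum]
      rw [Finset.sum_comm' (s := (S.erase u).filter (fun w => G.Adj u w))
        (t := fun w => (S.erase u).erase w) (t' := S.erase u)
        (s' := fun v => ((S.erase u).erase v).filter (fun w => G.Adj u w))]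
      · ring
      · intro a b
        simp only [Finset.mem_filter, Finset.mem_erase]
        tauto

lemma P_eval {V : Type*} [Fintype V] (G : SimpleGraph V) (S : Finset V) (z : ℝ) :
    (P G S).eval z = F G (fun _ => z) S := F_eval G S z

/-- If `(X - θ)^(2n) * R` is nonnegative everywhere then `R(θ) ≥ 0`. -/
lemma nonneg_of_factor (θ : ℝ) (n : ℕ) (Q R : ℝ[X]) (h : Q = (X - C θ) ^ (2 * n) * R)
    (hQ : ∀ z, 0 ≤ Q.eval z) : 0 ≤ R.eval θ := by
  have hc : ContinuousAt (fun z => R.eval z) θ := R.continuous.continuousAt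
  have ht : Filter.Tendsto (fun z => R.eval z) (nhdsWithin θ {θ}ᶜ) (nhds (R.eval θ)) :=
    hc.tendsto.mono_left nhdsWithin_le_nhds
  refine ge_of_tendsto ht ?_
  filter_upwards [self_mem_nhdsWithin] with z hz
  have h1 := hQ z
  rw [h, eval_mul, eval_pow, eval_sub, eval_X, eval_C, pow_mul] at h1
  have h2 : 0 < ((z - θ) ^ 2) ^ n := by
    have : z - θ ≠ 0 := sub_ne_zero.2 hz
    positivity
  exact nonneg_of_mul_nonneg_right h1 h2

lemma exists_factor {V : Type*} [Fintype V] (G : SimpleGraph V) (θ : ℝ) (S : Finset V) :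
    ∃ B : ℝ[X], P G S = (X - C θ) ^ (rootMultiplicity θ (P G S)) * B ∧ B.eval θ ≠ 0 := by
  obtain ⟨B, h1, h2⟩ := exists_eq_pow_rootMultiplicity_mul_and_not_dvd (P G S) (P_ne_zero G S) θ
  exact ⟨B, h1, fun h => h2 (dvd_iff_isRoot.2 h)⟩

lemma dvd_of_le {V : Type*} [Fintype V] (G : SimpleGraph V) (θ : ℝ) (S : Finset V) (n : ℕ)
    (h : n ≤ rootMultiplicity θ (P G S)) : (X - C θ) ^ n ∣ P G S :=
  (le_rootMultiplicity_iff (P_ne_zero G S)).1 h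

open Classical in
lemma adj_mult {V : Type*} [Fintype V] (G : SimpleGraph V) (θ : ℝ) (S : Finset V) (u v : V)
    (hu : u ∈ S) (hv : v ∈ S) (huv : G.Adj u v) (k : ℕ)
    (h0 : k + 1 ≤ rootMultiplicity θ (P G S))
    (h1 : k ≤ rootMultiplicity θ (P G (S.erase u)))
    (h2 : k ≤ rootMultiplicity θ (P G (S.erase v))) :
    k ≤ rootMultiplicity θ (P G ((S.erase u).erase v)) := by
  by_contra! hlt
  obtain ⟨D, hD, hD0⟩ := exists_factor G θ ((S.erase u).erase v)
  generalize rootMultiplicity θ (P G ((S.erase u).erase v)) = j at *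
  obtain ⟨A, hA⟩ := dvd_of_le G θ _ (j + 1) (by omega : j + 1 ≤ rootMultiplicity θ (P G S))
  obtain ⟨B, hB⟩ := dvd_of_le G θ _ (j + 1)
    (by omega : j + 1 ≤ rootMultiplicity θ (P G (S.erase u)))
  obtain ⟨E, hE⟩ := dvd_of_le G θ _ (j + 1)
    (by omega : j + 1 ≤ rootMultiplicity θ (P G (S.erase v)))
  have := nonneg_of_factor θ j
    (P G (S.erase u) * P G (S.erase v) - P G S * P G ((S.erase u).erase v)
      - P G ((S.erase u).erase v) ^ 2)
    ((X - C θ) * ((X - C θ) * B * E - A * D) - D ^ 2)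
    (by rw [hA, hB, hE, hD]; ring)
    (fun z => by
      have := rayleigh G (fun _ => z) _ S u v rfl hu hv huv.ne
      rw [if_pos huv] at this
      simp only [eval_sub, eval_mul, eval_pow, P_eval]
      linarith)
  simp at this
  exact hD0 (by nlinarith [sq_nonneg (D.eval θ)])

open Classical in
lemma interlace {V : Type*} [Fintype V] (G : SimpleGraph V) (θ : ℝ) (S : Finset V) (w : V)
    (hw : w ∈ S) :
    rootMultiplicity θ (P G S) ≤ rootMultiplicity θ (P G (S.erase w)) + 1 := by
  by_contra! hlt
  obtain ⟨D, hD, hD0⟩ := exists_factor G θ (S.erase w)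
  generalize rootMultiplicity θ (P G (S.erase w)) = j at *
  obtain ⟨A, hA⟩ := dvd_of_le G θ _ (j + 2) (by omega : j + 2 ≤ rootMultiplicity θ (P G S))
  have hdA : derivative (P G S) =
      (X - C θ) ^ (j + 1) * (C ((j : ℝ) + 2) * A + (X - C θ) * derivative A) := by
    rw [hA, derivative_mul, derivative_X_sub_C_pow]
    push_cast
    simp only [Nat.add_sub_cancel, show j + 2 - 1 = j + 1 by omega, map_add, map_natCast,
      map_ofNat]
    ring
  have hdD : (X - C θ) * derivative (P G (S.erase w)) =
      (X - C θ) ^ j * (C (j : ℝ) * D + (X - C θ) * derivative D) := by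
    rw [hD, derivative_mul, derivative_X_sub_C_pow]
    rcases j with _ | j
    · simp
    · simp only [Nat.add_sub_cancel]
      push_cast
      ring
  have := nonneg_of_factor θ j
    (P G (S.erase w) * derivative (P G S) - P G S * derivative (P G (S.erase w))
      - P G (S.erase w) ^ 2)
    ((X - C θ) * (D * (C ((j : ℝ) + 2) * A + (X - C θ) * derivative A)
      - A * (C (j : ℝ) * D + (X - C θ) * derivative D)) - D ^ 2)
    (by
      have h3 : P G S * derivative (P G (S.erase w)) = (X - C θ) ^ (j + 1) * A *
          ((X - C θ) * derivative (P G (S.erase w))) := by rw [hA]; ring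
      rw [h3, hdA, hdD, hD]; ring)
    (fun z => by
      rw [P_deriv G _ S rfl, P_deriv G _ (S.erase w) rfl, ← Finset.add_sum_erase S _ hw]
      have : P G (S.erase w) * (P G (S.erase w) + ∑ x ∈ S.erase w, P G (S.erase x)) -
          P G S * ∑ v ∈ S.erase w, P G ((S.erase w).erase v) - P G (S.erase w) ^ 2 =
          ∑ v ∈ S.erase w, (P G (S.erase w) * P G (S.erase v) -
            P G S * P G ((S.erase w).erase v)) := by
        rw [Finset.sum_sub_distrib, ← Finset.mul_sum, ← Finset.mul_sum]; ring
      rw [this, eval_finsetSum]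
      refine Finset.sum_nonneg fun v hv => ?_
      rw [Finset.mem_erase] at hv
      simp only [eval_sub, eval_mul, P_eval]
      exact rayleigh' G _ S w v hw hv.2 hv.1.symm)
  simp at this
  exact hD0 (by nlinarith [sq_nonneg (D.eval θ)])

open Classical in
lemma exists_essential {V : Type*} [Fintype V] (G : SimpleGraph V) (θ : ℝ) (S : Finset V)
    (h : 1 ≤ rootMultiplicity θ (P G S)) :
    ∃ v ∈ S, rootMultiplicity θ (P G (S.erase v)) < rootMultiplicity θ (P G S) := by
  by_contra! hall
  have hdvd : (X - C θ) ^ rootMultiplicity θ (P G S) ∣ derivative (P G S) := by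
    rw [P_deriv G _ S rfl]
    exact Finset.dvd_sum fun v hv => dvd_of_le G θ _ _ (hall v hv)
  have hroot : (P G S).IsRoot θ :=
    ((rootMultiplicity_pos (P_ne_zero G S)).1 h)
  have hm := derivative_rootMultiplicity_of_root hroot
  have hne : derivative (P G S) ≠ 0 := by
    intro h0
    have := natDegree_eq_zero_of_derivative_eq_zero h0
    have hC := eq_C_of_natDegree_eq_zero this
    rw [hC] at hroot
    simp at hroot
    rw [hroot] at hC
    exact P_ne_zero G S (by rw [hC]; simp)
  have := (le_rootMultiplicity_iff hne).2 hdvd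
  omega

open Classical in
lemma trans_mult {V : Type*} [Fintype V] (G : SimpleGraph V) (θ : ℝ) (S : Finset V) (u v w : V)
    (hu : u ∈ S) (hv : v ∈ S) (hw : w ∈ S) (huv : u ≠ v) (hvw : v ≠ w) (huw : u ≠ w) (k : ℕ)
    (h0 : rootMultiplicity θ (P G S) = k + 1)
    (hmu : rootMultiplicity θ (P G (S.erase u)) = k)
    (hmv : rootMultiplicity θ (P G (S.erase v)) = k)
    (hmw : rootMultiplicity θ (P G (S.erase w)) = k)
    (h1 : k ≤ rootMultiplicity θ (P G ((S.erase u).erase v)))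
    (h2 : k ≤ rootMultiplicity θ (P G ((S.erase v).erase w))) :
    k ≤ rootMultiplicity θ (P G ((S.erase u).erase w)) := by
  by_contra! hlt
  have hi := interlace G θ (S.erase u) w (by simp [hw, huw.symm])
  have hi2 := interlace G θ ((S.erase u).erase v) w (by simp [hw, huw.symm, hvw.symm])
  obtain ⟨j, rfl⟩ : ∃ j, k = j + 1 := ⟨k - 1, by omega⟩
  obtain ⟨D, hD, hD0⟩ := exists_factor G θ ((S.erase u).erase w)
  rw [show rootMultiplicity θ (P G ((S.erase u).erase w)) = j by omega] at hD
  obtain ⟨B, hB, hB0⟩ := exists_factor G θ (S.erase v)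
  rw [hmv] at hB
  obtain ⟨A0, hA0⟩ := dvd_of_le G θ S (j + 2) (by omega)
  obtain ⟨A, hA⟩ := dvd_of_le G θ (S.erase u) (j + 1) (by omega)
  obtain ⟨W, hW⟩ := dvd_of_le G θ (S.erase w) (j + 1) (by omega)
  obtain ⟨U, hU⟩ := dvd_of_le G θ ((S.erase u).erase v) (j + 1) (by omega)
  obtain ⟨E, hE⟩ := dvd_of_le G θ ((S.erase v).erase w) (j + 1) (by omega)
  obtain ⟨T, hT⟩ := dvd_of_le G θ (((S.erase u).erase v).erase w) j (by omega)
  have key : ∀ s : ℝ, 0 ≤ (A.eval θ + s * D.eval θ) * B.eval θ := by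
    intro s
    have := nonneg_of_factor θ (j + 1)
      ((P G (S.erase u) + C s * (X - C θ) * P G ((S.erase u).erase w)) *
        (P G (S.erase v) + C s * (X - C θ) * P G ((S.erase v).erase w)) -
        (P G S + C s * (X - C θ) * P G (S.erase w)) *
        (P G ((S.erase u).erase v) + C s * (X - C θ) * P G (((S.erase u).erase v).erase w)))
      ((A + C s * D) * (B + C s * (X - C θ) * E) -
        (X - C θ) * (A0 + C s * W) * (U + C s * T))
      (by rw [hA, hB, hD, hE, hA0, hW, hU, hT]; ring)
      (fun z => by
        have hr := rayleigh' G (Function.update (fun _ => z) w (z + s * (z - θ))) S u v hu hv huv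
        have hs : ∀ T : Finset V, w ∈ T →
            F G (Function.update (fun _ => z) w (z + s * (z - θ))) T =
              F G (fun _ => z) T + s * (z - θ) * F G (fun _ => z) (T.erase w) :=
          fun T hT => F_shift G (fun _ => z) T w hT _
        rw [hs S hw, hs (S.erase u) (by simp [hw, huw.symm]),
          hs (S.erase v) (by simp [hw, hvw.symm]),
          hs ((S.erase u).erase v) (by simp [hw, huw.symm, hvw.symm])] at hr
        simpa only [eval_sub, eval_add, eval_mul, eval_X, eval_C, P_eval] using hr)
    simpa using this
  have hne : D.eval θ * B.eval θ ≠ 0 := mul_ne_zero hD0 hB0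
  have := key ((-1 - A.eval θ * B.eval θ) / (D.eval θ * B.eval θ))
  have h3 : (A.eval θ + (-1 - A.eval θ * B.eval θ) / (D.eval θ * B.eval θ) * D.eval θ) *
      B.eval θ = -1 := by
    field_simp
    ring
  linarith

end GallaiTheta

theorem gallai_lemma_theta_critical {V : Type*} [Finite V] (θ : ℝ) (G : SimpleGraph V)
    (hconn : G.Connected) (hcrit : ∀ u : V, IsEssential θ G u) :
    matchMult θ G = 1 := by
  classical
  have : Fintype V := Fintype.ofFinite V
  obtain ⟨u⟩ := hconn.nonempty
  have h0 : matchMult θ G = rootMultiplicity θ (GallaiTheta.P G Finset.univ) := by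
    rw [matchMult, GallaiTheta.mp_eq]; rfl
  have hE : ∀ v, rootMultiplicity θ (GallaiTheta.P G (Finset.univ.erase v)) + 1 =
      rootMultiplicity θ (GallaiTheta.P G Finset.univ) := by
    intro v
    have := hcrit v
    rw [IsEssential, h0, matchMult, GallaiTheta.mp_induce] at this
    rw [← this, GallaiTheta.P]
  rw [h0]
  obtain ⟨k, hk⟩ : ∃ k, rootMultiplicity θ (GallaiTheta.P G Finset.univ) = k + 1 :=
    ⟨_, (hE u).symm⟩
  have hE' : ∀ v, rootMultiplicity θ (GallaiTheta.P G (Finset.univ.erase v)) = k := by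
    intro v; have := hE v; omega
  have hadj : ∀ a b, G.Adj a b →
      k ≤ rootMultiplicity θ (GallaiTheta.P G ((Finset.univ.erase a).erase b)) := by
    intro a b hab
    have := GallaiTheta.adj_mult G θ Finset.univ a b (Finset.mem_univ _) (Finset.mem_univ _) hab k
      hk.ge (by convert (hE' a).ge) (by convert (hE' b).ge)
    convert this
  have hall : ∀ w, u = w ∨
      k ≤ rootMultiplicity θ (GallaiTheta.P G ((Finset.univ.erase u).erase w)) := by
    intro w
    have hr : Relation.ReflTransGen G.Adj u w :=
      (SimpleGraph.reachable_iff_reflTransGen u w).1 (hconn.preconnected u w)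
    induction hr with
    | refl => exact Or.inl rfl
    | @tail b c _ hbc ih =>
      by_cases huc : u = c
      · exact Or.inl huc
      right
      by_cases hub : u = b
      · subst hub; exact hadj _ _ hbc
      · have := GallaiTheta.trans_mult G θ Finset.univ u b c (Finset.mem_univ _)
          (Finset.mem_univ _) (Finset.mem_univ _) hub hbc.ne huc k hk
          (by convert hE' u) (by convert hE' b) (by convert hE' c)
          (by convert ih.resolve_left hub) (by convert hadj b c hbc)
        convert this
  by_contra hne
  obtain ⟨v, hv, hlt⟩ := GallaiTheta.exists_essential G θ (Finset.univ.erase u)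
    (by rw [hE' u]; omega)
  rw [hE' u] at hlt
  rcases hall v with rfl | h
  · simp at hv
  · have h' : rootMultiplicity θ (GallaiTheta.P G ((Finset.univ.erase u).erase v)) < k := by
      convert hlt
    omega
end

section
/- Let G be a finite connected vertex-transitive simple graph, i.e., for any two vertices u, v of G there is a graph automorphism of G mapping u to v. Then every root of the matching polynomial of G is simple: for every θ ∈ ℝ, the multiplicity of θ as a root of μ(G,z) is at most 1. -/
open Polynomial

section Helpers
open Finset

/-- abstract recurrence -/
def MRec {V R : Type*} [DecidableEq V] [CommRing R] (G : SimpleGraph V) [DecidableRel G.Adj]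
    (y : V → R) (d : Finset V → R) : Prop :=
  ∀ S : Finset V, ∀ u ∈ S, d S = y u * d (S.erase u) -
    ∑ w ∈ (S.erase u).filter (G.Adj u), d ((S.erase u).erase w)

lemma MRec.nonneg {V : Type*} [DecidableEq V] {G : SimpleGraph V} [DecidableRel G.Adj]
    {y : V → ℝ} {d : Finset V → ℝ} (h : MRec G y d) :
    ∀ (n : ℕ) (S : Finset V), S.card = n → ∀ u ∈ S, ∀ v ∈ S, u ≠ v →
      (if G.Adj u v then d ((S.erase u).erase v) ^ 2 else 0) ≤
      d (S.erase u) * d (S.erase v) - d S * d ((S.erase u).erase v) := by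
  intro n
  induction n with
  | zero =>
    intro S hS u hu
    rw [Finset.card_eq_zero] at hS
    simp [hS] at hu
  | succ n ih =>
    intro S hS u hu v hv huv
    have hT : (S.erase u).card = n := by rw [card_erase_of_mem hu, hS]; rfl
    have hvT : v ∈ S.erase u := mem_erase.2 ⟨huv.symm, hv⟩
    have e1 := h S u hu
    have e2 := h (S.erase v) u (mem_erase.2 ⟨huv, hu⟩)
    rw [erase_right_comm] at e2
    set T := S.erase u with hTdef
    have e3 : ∑ w ∈ T.filter (G.Adj u), d (T.erase w) =
        (if G.Adj u v then d (T.erase v) else 0) +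
          ∑ w ∈ (T.erase v).filter (G.Adj u), d (T.erase w) := by
      rw [sum_filter, sum_filter, ← add_sum_erase T _ hvT]
    have e4 : 0 ≤ ∑ w ∈ (T.erase v).filter (G.Adj u),
        (d (T.erase v) * d (T.erase w) - d T * d ((T.erase v).erase w)) := by
      apply sum_nonneg
      intro w hw
      simp only [mem_filter, mem_erase] at hw
      refine le_trans ?_ (ih T hT v hvT w hw.1.2 hw.1.1.symm)
      split_ifs <;> positivity
    rw [sum_sub_distrib, ← mul_sum, ← mul_sum] at e4
    rw [e2, e1, e3]
    split_ifs with hadj <;> nlinarith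

lemma MRec.twist {V : Type*} [DecidableEq V] {G : SimpleGraph V} [DecidableRel G.Adj]
    {y : V → ℝ} {d : Finset V → ℝ} (h : MRec G y d) (v : V) (t : ℝ) :
    MRec G (fun u => y u + if u = v then t else 0)
      (fun S => d S + if v ∈ S then t * d (S.erase v) else 0) := by
  intro S u hu
  have e1 := h S u hu
  by_cases huv : u = v
  · subst huv
    simp [hu]
    rw [e1]; ring
  · by_cases hv : v ∈ S
    · have e2 := h (S.erase v) u (mem_erase.2 ⟨huv, hu⟩)
      have hvT : v ∈ S.erase u := mem_erase.2 ⟨fun h => huv h.symm, hv⟩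
      rw [erase_right_comm] at e2
      simp only [hv, huv, hvT, if_true, if_false]
      rw [e1, e2, sum_add_distrib]
      have : ∑ w ∈ (S.erase u).filter (G.Adj u),
          (if v ∈ (S.erase u).erase w then t * d (((S.erase u).erase w).erase v) else 0)
          = t * ∑ w ∈ ((S.erase u).erase v).filter (G.Adj u), d (((S.erase u).erase v).erase w) := by
        rw [sum_filter, sum_filter, ← add_sum_erase (S.erase u) _ hvT, mul_sum]
        simp only [notMem_erase, if_false, ite_self, zero_add]
        apply sum_congr rfl
        intro w hw
        have hw' : v ≠ w := fun h => by simp [h] at hw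
        rw [if_pos (mem_erase.2 ⟨hw', hvT⟩), erase_right_comm]
        split_ifs <;> simp
      rw [this]; ring
    · simp [hv, huv, e1]

lemma MRec.disc {V : Type*} [DecidableEq V] {G : SimpleGraph V} [DecidableRel G.Adj]
    {y : V → ℝ} {d : Finset V → ℝ} (h : MRec G y d) (S : Finset V) (u v w : V)
    (hu : u ∈ S) (hv : v ∈ S) (hw : w ∈ S) (huv : u ≠ v) (hvw : v ≠ w) (huw : u ≠ w) :
    (d ((S.erase u).erase v) * d (S.erase w) + d (S.erase u) * d ((S.erase w).erase v)
      - d S * d (((S.erase u).erase w).erase v) - d (S.erase v) * d ((S.erase u).erase w)) ^ 2 ≤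
    4 * (d ((S.erase u).erase v) * d ((S.erase w).erase v)
        - d (S.erase v) * d (((S.erase u).erase w).erase v)) *
      (d (S.erase u) * d (S.erase w) - d S * d ((S.erase u).erase w)) := by
  have key : ∀ t : ℝ, 0 ≤
      (d ((S.erase u).erase v) * d ((S.erase w).erase v)
        - d (S.erase v) * d (((S.erase u).erase w).erase v)) * (t * t) +
      (d ((S.erase u).erase v) * d (S.erase w) + d (S.erase u) * d ((S.erase w).erase v)
      - d S * d (((S.erase u).erase w).erase v) - d (S.erase v) * d ((S.erase u).erase w)) * t +
      (d (S.erase u) * d (S.erase w) - d S * d ((S.erase u).erase w)) := by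
    intro t
    have := (h.twist v t).nonneg _ S rfl u hu w hw huw
    have h0 : ∀ x : ℝ, 0 ≤ if G.Adj u w then x ^ 2 else 0 := by
      intro x; split_ifs <;> positivity
    have := (h0 _).trans this
    simp only [mem_erase, hv, huv.symm, hvw, ne_eq, not_false_eq_true, and_self, if_true] at this
    linarith
  have := discrim_le_zero key
  rw [discrim] at this
  linarith

variable {θ : ℝ}

lemma pointwise_ext {P : ℝ[X]} (h : ∀ x, x ≠ θ → 0 ≤ P.eval x) : ∀ x, 0 ≤ P.eval x := by
  have hc : IsClosed {x : ℝ | 0 ≤ P.eval x} := isClosed_le continuous_const P.continuous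
  have hd : Dense ({θ}ᶜ : Set ℝ) := dense_compl_singleton θ
  intro x
  have : closure ({θ}ᶜ : Set ℝ) ⊆ {x : ℝ | 0 ≤ P.eval x} :=
    hc.closure_subset_iff.2 (fun x hx => h x hx)
  exact this (hd x)

lemma dvd_of_sq_le (n : ℕ) : ∀ (P Q : ℝ[X]), (∀ x, Q.eval x ^ 2 ≤ P.eval x) →
    (X - C θ) ^ (2 * n) ∣ P → (X - C θ) ^ n ∣ Q := by
  induction n with
  | zero => intro P Q _ _; simp
  | succ n ih =>
    intro P Q h hP
    obtain ⟨R, rfl⟩ := hP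
    have h1 : Q.eval θ = 0 := by
      have := h θ
      simp at this
      exact this
    obtain ⟨Q1, rfl⟩ := dvd_iff_isRoot.2 h1
    have := ih ((X - C θ) ^ (2 * n) * R) Q1 ?_ (dvd_mul_right _ _)
    · rw [pow_succ']
      exact mul_dvd_mul_left _ this
    · have : ∀ x, 0 ≤ ((X - C θ) ^ (2 * n) * R - Q1 ^ 2).eval x := by
        apply pointwise_ext (θ := θ)
        intro x hx
        have hx' : 0 < (x - θ) ^ 2 := by
          have : x - θ ≠ 0 := sub_ne_zero.2 hx
          positivity
        have := h x
        simp only [eval_mul, eval_pow, eval_sub, eval_X, eval_C] at this ⊢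
        by_contra hneg
        push Not at hneg
        have h3 := mul_neg_of_pos_of_neg hx' hneg
        have h4 : (x - θ) ^ (2 * (n + 1)) = (x - θ) ^ 2 * (x - θ) ^ (2 * n) := by ring
        rw [h4] at this
        nlinarith
      intro x
      have := this x
      simp only [eval_sub, eval_pow] at this
      linarith

lemma even_dvd (n : ℕ) (P : ℝ[X]) (h : ∀ x, 0 ≤ P.eval x)
    (hP : (X - C θ) ^ (2 * n + 1) ∣ P) : (X - C θ) ^ (2 * n + 2) ∣ P := by
  obtain ⟨R, rfl⟩ := hP
  have h1 : ∀ x, 0 ≤ ((X - C θ) * R).eval x := by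
    apply pointwise_ext (θ := θ)
    intro x hx
    have hx' : 0 < (x - θ) ^ (2 * n) := by
      have : x - θ ≠ 0 := sub_ne_zero.2 hx
      rw [pow_mul]
      positivity
    have := h x
    simp only [eval_mul, eval_pow, eval_sub, eval_X, eval_C] at this ⊢
    rw [pow_succ, mul_assoc] at this
    exact nonneg_of_mul_nonneg_right this hx'
  have hmin : IsLocalMin (fun x => ((X - C θ) * R).eval x) θ := by
    apply Filter.Eventually.of_forall
    intro x
    simpa using h1 x
  have h2 := hmin.deriv_eq_zero
  rw [Polynomial.deriv] at h2
  simp at h2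
  obtain ⟨Q, rfl⟩ := dvd_iff_isRoot.2 h2
  exact ⟨Q, by ring⟩

lemma dvd_of_deriv (j : ℕ) (f : ℝ[X]) (h : (X - C θ) ^ (j + 1) ∣ f)
    (h' : (X - C θ) ^ (j + 1) ∣ derivative f) : (X - C θ) ^ (j + 2) ∣ f := by
  obtain ⟨g, rfl⟩ := h
  have h1 : derivative ((X - C θ) ^ (j + 1) * g) =
      (X - C θ) ^ j * (C ((j : ℝ) + 1) * g) + (X - C θ) ^ (j + 1) * derivative g := by
    rw [derivative_mul, derivative_X_sub_C_pow]
    simp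
    ring
  rw [h1, dvd_add_left (dvd_mul_right _ _), pow_succ] at h'
  have h2 := (mul_dvd_mul_iff_left (pow_ne_zero j (X_sub_C_ne_zero θ))).1 h'
  have h3 : (X - C θ) ∣ g := by
    rw [dvd_iff_isRoot] at h2 ⊢
    simp only [IsRoot, eval_mul, eval_C] at h2 ⊢
    rcases mul_eq_zero.1 h2 with h4 | h4
    · exact absurd h4 (by positivity)
    · exact h4
  rw [pow_succ _ (j + 1)]
  exact mul_dvd_mul_left _ h3

lemma dvd_deriv (j : ℕ) (f : ℝ[X]) (h : (X - C θ) ^ (j + 1) ∣ f) :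
    (X - C θ) ^ j ∣ derivative f := by
  obtain ⟨g, rfl⟩ := h
  rw [derivative_mul, derivative_X_sub_C_pow]
  simp only [Nat.add_sub_cancel]
  exact dvd_add (dvd_mul_of_dvd_left (dvd_mul_left _ _) _)
    (dvd_mul_of_dvd_left (pow_dvd_pow _ (Nat.le_succ j)) _)

lemma MRec.eval {V : Type*} [DecidableEq V] {G : SimpleGraph V} [DecidableRel G.Adj]
    {D : Finset V → ℝ[X]} (h : MRec G (fun _ => X) D) (x : ℝ) :
    MRec G (fun _ => x) (fun S => (D S).eval x) := by
  intro S u hu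
  have := congrArg (Polynomial.eval x) (h S u hu)
  simpa [eval_finsetSum] using this

lemma MRec.derivative {V : Type*} [DecidableEq V] {G : SimpleGraph V} [DecidableRel G.Adj]
    {D : Finset V → ℝ[X]} (h0 : D ∅ = 1) (h : MRec G (fun _ => X) D) :
    ∀ (n : ℕ) (S : Finset V), S.card = n →
      Polynomial.derivative (D S) = ∑ v ∈ S, D (S.erase v) := by
  intro n
  induction n using Nat.strong_induction_on with
  | _ n ih =>
    intro S hS
    rcases S.eq_empty_or_nonempty with rfl | ⟨u, hu⟩
    · simp [h0]
    · have hc : (S.erase u).card < n := by rw [← hS]; exact card_erase_lt_of_mem hu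
      have hA : ∀ w ∈ S.erase u, Polynomial.derivative (D ((S.erase u).erase w)) =
          ∑ v ∈ (S.erase u).erase w, D (((S.erase u).erase w).erase v) := by
        intro w hw
        exact ih _ ((card_erase_lt_of_mem hw).trans hc) _ rfl
      rw [← add_sum_erase S _ hu, h S u hu]
      set T := S.erase u with hT
      have hB : ∀ v ∈ T, D (S.erase v) = X * D (T.erase v) -
          ∑ w ∈ (T.erase v).filter (G.Adj u), D ((T.erase v).erase w) := by
        intro v hv
        have := h (S.erase v) u (mem_erase.2 ⟨fun h => by simp [hT, h] at hv, hu⟩)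
        rwa [erase_right_comm] at this
      rw [sum_congr rfl hB, sum_sub_distrib, ← mul_sum]
      simp only [derivative_sub, derivative_mul, derivative_X, one_mul, derivative_sum]
      rw [ih _ hc T rfl, sum_congr rfl (fun w hw => hA w (mem_filter.1 hw).1)]
      have : ∑ w ∈ T.filter (G.Adj u), ∑ v ∈ T.erase w, D ((T.erase w).erase v) =
          ∑ v ∈ T, ∑ w ∈ (T.erase v).filter (G.Adj u), D ((T.erase v).erase w) := by
        rw [sum_comm' (t' := T) (s' := fun v => (T.erase v).filter (G.Adj u))]
        · refine sum_congr rfl fun v _ => sum_congr rfl fun w _ => ?_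
          rw [erase_right_comm]
        · intro w v
          simp only [mem_filter, mem_erase]
          constructor
          · rintro ⟨⟨a, b⟩, c, d⟩; exact ⟨⟨⟨c.symm, a⟩, b⟩, d⟩
          · rintro ⟨⟨⟨c, a⟩, b⟩, d⟩; exact ⟨⟨a, b⟩, c.symm, d⟩
      rw [this]
      ring

lemma MRec.iso {V : Type*} [DecidableEq V] {G : SimpleGraph V} [DecidableRel G.Adj]
    {D : Finset V → ℝ[X]} (h : MRec G (fun _ => X) D) (φ : G ≃g G) :
    ∀ (n : ℕ) (S : Finset V), S.card = n → D (S.image φ) = D S := by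
  intro n
  induction n using Nat.strong_induction_on with
  | _ n ih =>
    intro S hS
    rcases S.eq_empty_or_nonempty with rfl | ⟨u, hu⟩
    · simp
    · have hc : (S.erase u).card < n := by rw [← hS]; exact card_erase_lt_of_mem hu
      have he : ∀ (A : Finset V) (a : V), (A.image φ).erase (φ a) = (A.erase a).image φ :=
        fun A a => (image_erase φ.injective A a).symm
      rw [h S u hu, h (S.image φ) (φ u) (mem_image_of_mem _ hu), he, ih _ hc _ rfl]
      congr 1
      have : ((S.erase u).image φ).filter (G.Adj (φ u)) = ((S.erase u).filter (G.Adj u)).image φ := by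
        rw [filter_image]
        congr 1
        ext a
        simp only [mem_filter]
        rw [φ.map_adj_iff]
      rw [this, sum_image (fun a _ b _ hab => φ.injective hab)]
      apply sum_congr rfl
      intro w hw
      rw [he, ih _ ((card_erase_lt_of_mem (mem_filter.1 hw).1).trans hc) _ rfl]

lemma MRec.nonzero {V : Type*} [DecidableEq V] {G : SimpleGraph V} [DecidableRel G.Adj]
    {D : Finset V → ℝ[X]} (h0 : D ∅ = 1) (h : MRec G (fun _ => X) D) :
    ∀ (n : ℕ) (S : Finset V), S.card = n → D S ≠ 0 := by
  intro n
  induction n with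
  | zero => intro S hS; rw [Finset.card_eq_zero.1 hS, h0]; exact one_ne_zero
  | succ n ih =>
    intro S hS h1
    obtain ⟨u, hu⟩ : S.Nonempty := card_pos.1 (by omega)
    have h2 := MRec.derivative h0 h _ S rfl
    have hcard : ∀ v ∈ S, (S.erase v).card = n := fun v hv => by
      rw [card_erase_of_mem hv, hS]; rfl
    -- Wronskian positivity: f' g - f g' ≥ g²
    have hg := ih (S.erase u) (hcard u hu)
    apply hg
    apply Polynomial.funext
    intro x
    have h3 : ∀ v ∈ S.erase u, 0 ≤ (D (S.erase u)).eval x * (D (S.erase v)).eval x := by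
      intro v hv
      rw [mem_erase] at hv
      have := (h.eval x).nonneg _ S rfl u hu v hv.2 hv.1.symm
      simp only [h1, eval_zero, zero_mul, sub_zero] at this
      refine le_trans ?_ this
      split_ifs <;> positivity
    have h4 := sum_nonneg h3
    rw [← mul_sum] at h4
    rw [← add_sum_erase S _ hu, h1] at h2
    have h5 := congrArg (Polynomial.eval x) h2
    simp only [derivative_zero, eval_zero, eval_add, eval_finsetSum] at h5
    simp only [eval_zero]
    nlinarith [sq_nonneg ((D (S.erase u)).eval x)]

/-- interlacing -/
lemma MRec.interlace {V : Type*} [DecidableEq V] {G : SimpleGraph V} [DecidableRel G.Adj]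
    {D : Finset V → ℝ[X]} (h0 : D ∅ = 1) (h : MRec G (fun _ => X) D)
    (S : Finset V) (u : V) (hu : u ∈ S) (j : ℕ) (hd : (X - C θ) ^ (j + 1) ∣ D S) :
    (X - C θ) ^ j ∣ D (S.erase u) := by
  induction j with
  | zero => simp
  | succ n ih =>
    have hg := ih ((pow_dvd_pow _ (Nat.le_succ _)).trans hd)
    have hW : ∀ x, (D (S.erase u)).eval x ^ 2 ≤
        (Polynomial.derivative (D S) * D (S.erase u) -
          D S * Polynomial.derivative (D (S.erase u))).eval x := by
      intro x
      rw [MRec.derivative h0 h _ S rfl, MRec.derivative h0 h _ _ rfl, ← add_sum_erase S _ hu]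
      have h3 : ∀ v ∈ S.erase u, 0 ≤ (D (S.erase u)).eval x * (D (S.erase v)).eval x
          - (D S).eval x * (D ((S.erase u).erase v)).eval x := by
        intro v hv
        rw [mem_erase] at hv
        have := (h.eval x).nonneg _ S rfl u hu v hv.2 hv.1.symm
        refine le_trans ?_ this
        split_ifs <;> positivity
      have h4 := sum_nonneg h3
      rw [sum_sub_distrib, ← mul_sum, ← mul_sum] at h4
      simp only [eval_sub, eval_mul, eval_add, eval_finsetSum]
      nlinarith
    apply dvd_of_sq_le (n + 1) _ _ hW
    apply even_dvd n _ (fun x => (sq_nonneg _).trans (hW x))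
    apply dvd_sub
    · have := mul_dvd_mul (dvd_deriv _ _ hd) hg
      rw [← pow_add] at this
      convert this using 2
      ring
    · rcases n with _ | n
      · apply dvd_mul_of_dvd_left
        exact (pow_dvd_pow _ (by omega)).trans hd
      · have := mul_dvd_mul hd (dvd_deriv _ _ hg)
        rw [← pow_add] at this
        exact (pow_dvd_pow _ (by omega)).trans this

lemma pow_dvd_mul {p a b : ℝ[X]} {i j n : ℕ} (ha : p ^ i ∣ a) (hb : p ^ j ∣ b) (hn : n ≤ i + j) :
    p ^ n ∣ a * b :=
  (pow_dvd_pow p hn).trans (by rw [pow_add]; exact mul_dvd_mul ha hb)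

theorem MRec.main {V : Type*} [Fintype V] [DecidableEq V] {G : SimpleGraph V} [DecidableRel G.Adj]
    {D : Finset V → ℝ[X]} (h0 : D ∅ = 1) (h : MRec G (fun _ => X) D)
    (hconn : G.Connected) (htrans : ∀ u v : V, ∃ φ : G ≃g G, φ u = v) :
    rootMultiplicity θ (D univ) ≤ 1 := by
  by_contra hcon
  have hne := MRec.nonzero h0 h _ univ rfl
  obtain ⟨j, hj⟩ : ∃ j, rootMultiplicity θ (D univ) = j + 2 :=
    ⟨rootMultiplicity θ (D univ) - 2, by omega⟩
  have hf : (X - C θ) ^ (j + 2) ∣ D univ := (le_rootMultiplicity_iff hne).1 hj.ge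
  have hf' : ¬ (X - C θ) ^ (j + 3) ∣ D univ := fun hh => by
    have := (le_rootMultiplicity_iff hne).2 hh
    omega
  have hder := MRec.derivative h0 h _ univ rfl
  have h1 : ∀ u, (X - C θ) ^ (j + 1) ∣ D (univ.erase u) := fun u =>
    MRec.interlace h0 h univ u (mem_univ u) _ hf
  have h1' : ∀ u, ¬ (X - C θ) ^ (j + 2) ∣ D (univ.erase u) := by
    intro u hu
    apply hf'
    apply dvd_of_deriv _ _ hf
    rw [hder]
    apply dvd_sum
    intro v _
    obtain ⟨φ, hφ⟩ := htrans u v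
    have : (univ.erase u).image φ = univ.erase v := by
      rw [image_erase φ.injective, hφ, image_univ_of_surjective φ.surjective]
    rw [← this, h.iso φ _ _ rfl]
    exact hu
  have hadj : ∀ u v, G.Adj u v → (X - C θ) ^ (j + 1) ∣ D ((univ.erase u).erase v) := by
    intro u v huv
    apply dvd_of_sq_le (j + 1) (D (univ.erase u) * D (univ.erase v)
      - D univ * D ((univ.erase u).erase v))
    · intro x
      have := (h.eval x).nonneg _ univ rfl u (mem_univ u) v (mem_univ v) huv.ne
      simpa [huv] using this
    · apply dvd_sub
      · exact pow_dvd_mul (h1 u) (h1 v) (by omega)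
      · exact pow_dvd_mul hf (MRec.interlace h0 h _ v
          (mem_erase.2 ⟨huv.ne', mem_univ v⟩) _ (h1 u)) (by omega)
  have htr : ∀ u v w, u ≠ v → v ≠ w → u ≠ w →
      (X - C θ) ^ (j + 1) ∣ D ((univ.erase u).erase v) →
      (X - C θ) ^ (j + 1) ∣ D ((univ.erase v).erase w) →
      (X - C θ) ^ (j + 1) ∣ D ((univ.erase u).erase w) := by
    intro u v w huv hvw huw huv' hvw'
    rw [erase_right_comm] at hvw'
    have huw' : (X - C θ) ^ j ∣ D ((univ.erase u).erase w) :=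
      MRec.interlace h0 h _ w (mem_erase.2 ⟨huw.symm, mem_univ w⟩) _ (h1 u)
    have huvw : (X - C θ) ^ j ∣ D (((univ.erase u).erase w).erase v) := by
      rw [erase_right_comm]
      exact MRec.interlace h0 h _ w (by simp [huw.symm, hvw.symm]) _ huv'
    have hdisc := fun x => (h.eval x).disc univ u v w (mem_univ _) (mem_univ _) (mem_univ _)
      huv hvw huw
    have hF : (X - C θ) ^ (2 * j + 2) ∣ D (univ.erase u) * D (univ.erase w)
      - D univ * D ((univ.erase u).erase w) :=
      dvd_sub (pow_dvd_mul (h1 u) (h1 w) (by omega)) (pow_dvd_mul hf huw' (by omega))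
    have hF' : (X - C θ) ^ (2 * j + 2) ∣ D ((univ.erase u).erase v) * D ((univ.erase w).erase v)
      - D (univ.erase v) * D (((univ.erase u).erase w).erase v) := by
      apply even_dvd
      · intro x
        have := (h.eval x).nonneg _ (univ.erase v) rfl u (by simp [huv]) w (by simp [hvw.symm]) huw
        rw [erase_right_comm (a := v) (b := u), erase_right_comm (a := v) (b := w),
          erase_right_comm (a := v) (b := w)] at this
        simp only [eval_sub, eval_mul]
        refine le_trans ?_ this
        split_ifs <;> positivity
      · exact dvd_sub (pow_dvd_mul huv' hvw' (by omega)) (pow_dvd_mul (h1 v) huvw (by omega))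
    have hc : (X - C θ) ^ (2 * j + 2) ∣
        D ((univ.erase u).erase v) * D (univ.erase w) + D (univ.erase u) * D ((univ.erase w).erase v)
      - D univ * D (((univ.erase u).erase w).erase v) - D (univ.erase v) * D ((univ.erase u).erase w) := by
      apply dvd_of_sq_le (2 * j + 2) (4 * (D ((univ.erase u).erase v) * D ((univ.erase w).erase v)
        - D (univ.erase v) * D (((univ.erase u).erase w).erase v)) *
        (D (univ.erase u) * D (univ.erase w) - D univ * D ((univ.erase u).erase w)))
      · intro x
        have := hdisc x
        simpa using this
      · exact pow_dvd_mul (dvd_mul_of_dvd_right hF' 4) hF (by omega)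
    have hc' : (X - C θ) ^ (2 * j + 2) ∣ D (univ.erase v) * D ((univ.erase u).erase w) := by
      refine (dvd_sub_right ?_).1 hc
      exact dvd_sub (dvd_add (pow_dvd_mul huv' (h1 w) (by omega))
        (pow_dvd_mul (h1 u) hvw' (by omega))) (pow_dvd_mul hf huvw (by omega))
    obtain ⟨q, hq⟩ := h1 v
    have hq' : ¬ (X - C θ) ∣ q := by
      rintro ⟨r, rfl⟩
      exact h1' v ⟨r, by rw [hq]; ring⟩
    rw [hq, show 2 * j + 2 = (j + 1) + (j + 1) by ring, pow_add, mul_assoc,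
      mul_dvd_mul_iff_left (pow_ne_zero _ (X_sub_C_ne_zero θ))] at hc'
    exact (prime_X_sub_C θ).pow_dvd_of_dvd_mul_left _ hq' hc'
  have hall : ∀ u v, u ≠ v → (X - C θ) ^ (j + 1) ∣ D ((univ.erase u).erase v) := by
    intro u v
    obtain ⟨p⟩ := hconn.preconnected u v
    induction p with
    | nil => intro hh; exact absurd rfl hh
    | @cons a b c hab p ih =>
      intro hac
      by_cases hbc : b = c
      · subst hbc; exact hadj _ _ hab
      · exact htr a b c hab.ne hbc hac (hadj _ _ hab) (ih hbc)
  obtain ⟨u⟩ := hconn.nonempty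
  apply h1' u
  apply dvd_of_deriv _ _ (h1 u)
  rw [MRec.derivative h0 h _ _ rfl]
  apply dvd_sum
  intro v hv
  exact hall u v (by simpa [eq_comm] using hv)

/-- matchings of `G` inside `S` -/
def IsMatch {V : Type*} (G : SimpleGraph V) (S : Finset V) (M : Finset (Sym2 V)) : Prop :=
  ((∀ e ∈ M, e ∈ G.edgeSet) ∧ ∀ e ∈ M, ∀ f ∈ M, e ≠ f → ∀ v, v ∈ e → v ∉ f) ∧
    ∀ e ∈ M, ∀ v ∈ e, v ∈ S

lemma IsMatch.card_le {V : Type*} {G : SimpleGraph V} {S : Finset V}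
    {M : Finset (Sym2 V)} (h : IsMatch G S M) : 2 * M.card ≤ S.card := by
  classical
  have h1 : (M.biUnion Sym2.toFinset).card = ∑ e ∈ M, e.toFinset.card := by
    apply card_biUnion
    intro e he f hf hef
    rw [Function.onFun, disjoint_left]
    intro v hv hv'
    rw [Sym2.mem_toFinset] at hv hv'
    exact h.1.2 e he f hf hef v hv hv'
  have h2 : ∑ e ∈ M, e.toFinset.card = ∑ e ∈ M, 2 := by
    apply sum_congr rfl
    intro e he
    exact Sym2.card_toFinset_of_not_isDiag e (G.not_isDiag_of_mem_edgeSet (h.1.1 e he))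
  have h3 : M.biUnion Sym2.toFinset ⊆ S := by
    intro v hv
    simp only [mem_biUnion, Sym2.mem_toFinset] at hv
    obtain ⟨e, he, hv⟩ := hv
    exact h.2 e he v hv
  have := card_le_card h3
  rw [h1, h2] at this
  simp at this
  omega

open Classical in
/-- matching polynomial of `G[S]` -/
noncomputable def mpoly {V : Type*} [Fintype V] (G : SimpleGraph V) (S : Finset V) : ℝ[X] :=
  ∑ M ∈ (univ : Finset (Finset (Sym2 V))).filter (IsMatch G S),
    (-1 : ℝ[X]) ^ M.card * X ^ (S.card - 2 * M.card)

lemma mpoly_empty {V : Type*} [Fintype V] (G : SimpleGraph V) : mpoly G ∅ = 1 := by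
  classical
  have : (univ : Finset (Finset (Sym2 V))).filter (IsMatch G ∅) = {∅} := by
    ext M
    simp only [mem_filter, mem_univ, true_and, mem_singleton]
    constructor
    · intro h
      have := h.card_le
      simpa using this
    · rintro rfl
      simp [IsMatch]
  rw [mpoly]
  convert_to ∑ M ∈ ({∅} : Finset (Finset (Sym2 V))), (-1 : ℝ[X]) ^ M.card * X ^ ((∅ : Finset V).card - 2 * M.card) = 1
  · rw [← this]
  · simp

lemma mpoly_rec {V : Type*} [Fintype V] [DecidableEq V] (G : SimpleGraph V) [DecidableRel G.Adj] :
    MRec G (fun _ => (X : ℝ[X])) (mpoly G) := by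
  classical
  intro S u hu
  have hcard := card_erase_add_one hu
  rw [mpoly, ← sum_filter_add_sum_filter_not _ (fun M => ∀ e ∈ M, u ∉ e), sub_eq_add_neg]
  congr 1
  · rw [mpoly, mul_sum]
    refine sum_congr ?_ ?_
    · ext M
      simp only [mem_filter, mem_univ, true_and, IsMatch, mem_erase]
      constructor
      · rintro ⟨⟨a, b⟩, c⟩
        exact ⟨a, fun e he v hv => ⟨fun hh => c e he (hh ▸ hv), b e he v hv⟩⟩
      · rintro ⟨a, b⟩
        exact ⟨⟨a, fun e he v hv => (b e he v hv).2⟩, fun e he hue => (b e he u hue).1 rfl⟩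
    · intro M hM
      have := (mem_filter.1 hM).2.card_le
      rw [show S.card - 2 * M.card = ((S.erase u).card - 2 * M.card) + 1 by omega, pow_succ]
      ring
  · rw [← sum_neg_distrib]
    simp only [mpoly]
    simp only [← sum_neg_distrib]
    rw [sum_sigma']
    symm
    have hnot : ∀ w (M : Finset (Sym2 V)), IsMatch G ((S.erase u).erase w) M → s(u, w) ∉ M := by
      intro w M hM hh
      have := hM.2 _ hh u (by simp)
      simp at this
    apply sum_bij (fun (p : Σ _ : V, Finset (Sym2 V)) _ => insert s(u, p.1) p.2)
    · rintro ⟨w, M⟩ hp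
      simp only [mem_sigma, mem_filter, mem_univ, true_and, mem_erase] at hp ⊢
      obtain ⟨⟨⟨hwu, hwS⟩, huw⟩, hM⟩ := hp
      refine ⟨⟨⟨?_, ?_⟩, ?_⟩, ?_⟩
      · intro e he
        rcases mem_insert.1 he with rfl | he
        · exact huw
        · exact hM.1.1 e he
      · intro e he f hf hef v hve hvf
        rcases mem_insert.1 he with rfl | he <;> rcases mem_insert.1 hf with rfl | hf
        · exact hef rfl
        · have := hM.2 f hf v hvf
          simp only [mem_erase] at this
          rcases Sym2.mem_iff.1 hve with h | h
          · exact this.2.1 h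
          · exact this.1 h
        · have := hM.2 e he v hve
          simp only [mem_erase] at this
          rcases Sym2.mem_iff.1 hvf with h | h
          · exact this.2.1 h
          · exact this.1 h
        · exact hM.1.2 e he f hf hef v hve hvf
      · intro e he v hv
        rcases mem_insert.1 he with rfl | he
        · rcases Sym2.mem_iff.1 hv with rfl | rfl
          · exact hu
          · exact hwS
        · have := hM.2 e he v hv
          simp only [mem_erase] at this
          exact this.2.2
      · intro hh
        exact hh s(u, w) (mem_insert_self _ _) (by simp)
    · rintro ⟨w, M⟩ hp ⟨w', M'⟩ hp' heq
      simp only [mem_sigma, mem_filter, mem_univ, true_and, mem_erase] at hp hp' heq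
      have hww : w = w' := by
        have h1 : s(u, w) ∈ insert s(u, w') M' := heq ▸ mem_insert_self _ _
        rcases mem_insert.1 h1 with h1 | h1
        · exact Sym2.congr_right.1 h1
        · have := hp'.2.2 _ h1 u (by simp)
          simp at this
      subst hww
      have : M = M' := by
        rw [← erase_insert (hnot w M hp.2), heq, erase_insert (hnot w M' hp'.2)]
      rw [this]
    · intro M hM
      simp only [mem_filter, mem_univ, true_and] at hM
      obtain ⟨hM, hM2⟩ := hM
      push Not at hM2
      obtain ⟨e, he, hue⟩ := hM2
      obtain ⟨w, rfl⟩ := hue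
      have huw : G.Adj u w := hM.1.1 _ he
      refine ⟨⟨w, M.erase s(u, w)⟩, ?_, insert_erase he⟩
      simp only [mem_sigma, mem_filter, mem_univ, true_and, mem_erase]
      refine ⟨⟨⟨huw.ne', hM.2 _ he w (by simp)⟩, huw⟩, ⟨?_, ?_⟩, ?_⟩
      · intro e he'
        exact hM.1.1 e (mem_of_mem_erase he')
      · intro e he' f hf'
        exact hM.1.2 e (mem_of_mem_erase he') f (mem_of_mem_erase hf')
      · intro e he' v hv
        have h1 := hM.1.2 e (mem_of_mem_erase he') _ he (ne_of_mem_erase he') v hv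
        simp only [Sym2.mem_iff, not_or] at h1
        simp only [mem_erase]
        exact ⟨h1.2, h1.1, hM.2 e (mem_of_mem_erase he') v hv⟩
    · rintro ⟨w, M⟩ hp
      simp only [mem_sigma, mem_filter, mem_univ, true_and] at hp
      have hw := card_erase_add_one hp.1.1
      rw [card_insert_of_notMem (hnot w M hp.2)]
      simp only
      rw [show S.card - 2 * (M.card + 1) = ((S.erase u).erase w).card - 2 * M.card by omega, pow_succ]
      ring

end Helpers

-- statement 1
theorem matching_poly_simple_roots_of_vertexTransitive {V : Type*} [Finite V]
    (G : SimpleGraph V) (hconn : G.Connected)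
    (htrans : ∀ u v : V, ∃ φ : G ≃g G, φ u = v) (θ : ℝ) :
    matchMult θ G ≤ 1 := by
  classical
  letI : Fintype V := Fintype.ofFinite V
  have h := MRec.main (θ := θ) (mpoly_empty G) (mpoly_rec G) hconn htrans
  have he : matchingPolynomial G = mpoly G Finset.univ := by
    rw [matchingPolynomial, mpoly]
    refine Finset.sum_congr ?_ ?_
    · ext M
      simp [IsMatch]
    · intro M _
      rw [Nat.card_eq_fintype_card, Finset.card_univ]
  rw [matchMult, he]
  exact h
end

section
/- Let θ ∈ ℝ and let G be a finite simple graph. Let D be the set of θ-essential vertices of G. Then every connected component of the induced subgraph G[D] is θ-critical: for every connected component C of G[D] and every vertex u of C, mult(θ, G[C] − u) = mult(θ, G[C]) − 1. -/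
open Polynomial

namespace EssCrit

section Rec
variable {V : Type*} [DecidableEq V]

/-- The vertex recurrence satisfied by (vertex weighted) matching polynomials. -/
def IsRec {R : Type*} [CommRing R] (adj : V → V → Prop) [DecidableRel adj] (x : V → R)
    (P : Finset V → R) : Prop :=
  ∀ S : Finset V, ∀ u ∈ S, P S = x u * P (S.erase u) -
    ∑ y ∈ (S.erase u).filter (adj u), P ((S.erase u).erase y)

/-- Heilmann-Lieb type inequality. -/
theorem rec_nonneg (adj : V → V → Prop) [DecidableRel adj]
    (x : V → ℝ) (f : Finset V → ℝ) (hf : IsRec adj x f) :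
    ∀ (n : ℕ) (S : Finset V), S.card = n → ∀ u ∈ S, ∀ v ∈ S, u ≠ v →
      (if adj u v then (f ((S.erase u).erase v)) ^ 2 else 0) ≤
        f (S.erase u) * f (S.erase v) - f S * f ((S.erase u).erase v) := by
  intro n
  induction n with
  | zero => 
    intro S hS u hu
    rw [Finset.card_eq_zero] at hS
    simp [hS] at hu
  | succ n ih =>
    intro S hS u hu v hv huv
    have h1 := hf S u hu
    have h2 := hf (S.erase v) u (Finset.mem_erase.2 ⟨huv, hu⟩)
    have hcomm : (S.erase v).erase u = (S.erase u).erase v := Finset.erase_right_comm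
    rw [hcomm] at h2
    have hvS : v ∈ S.erase u := Finset.mem_erase.2 ⟨huv.symm, hv⟩
    have hcard : (S.erase u).card = n := by rw [Finset.card_erase_of_mem hu, hS]; rfl
    have key : 0 ≤ ∑ y ∈ ((S.erase u).erase v).filter (adj u),
        (f ((S.erase u).erase y) * f ((S.erase u).erase v)
          - f (S.erase u) * f (((S.erase u).erase v).erase y)) := by
      apply Finset.sum_nonneg
      intro y hy
      rw [Finset.mem_filter, Finset.mem_erase] at hy
      have := ih (S.erase u) hcard y hy.1.2 v hvS hy.1.1
      have hc : ((S.erase u).erase v).erase y = ((S.erase u).erase y).erase v :=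
        Finset.erase_right_comm
      rw [hc]
      refine le_trans ?_ this
      split_ifs <;> positivity
    have hsum : ∑ y ∈ (S.erase u).filter (adj u), f ((S.erase u).erase y) =
        (if adj u v then f ((S.erase u).erase v) else 0) +
        ∑ y ∈ ((S.erase u).erase v).filter (adj u), f ((S.erase u).erase y) := by
      rw [Finset.sum_filter, Finset.sum_filter, ← Finset.add_sum_erase _ _ hvS]
    rw [Finset.sum_sub_distrib, ← Finset.sum_mul, ← Finset.mul_sum] at key
    rw [hsum] at h1
    rw [h1, h2]
    split_ifs at * <;> nlinarith [key]

open Polynomial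

theorem IsRec.eval {adj : V → V → Prop} [DecidableRel adj] {x : V → ℝ[X]}
    {P : Finset V → ℝ[X]} (h : IsRec adj x P) (t : ℝ) :
    IsRec adj (fun v => (x v).eval t) (fun S => (P S).eval t) := by
  intro S u hu
  have := congrArg (Polynomial.eval t) (h S u hu)
  simpa [Polynomial.eval_finsetSum] using this

/-- derivative -/
theorem rec_deriv (adj : V → V → Prop) [DecidableRel adj]
    (P : Finset V → ℝ[X]) (h : IsRec adj (fun _ => X) P) (h0 : P ∅ = 1) :
    ∀ (n : ℕ) (S : Finset V), S.card = n → derivative (P S) = ∑ u ∈ S, P (S.erase u) := by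
  intro n
  induction n using Nat.strong_induction_on with
  | _ n ih =>
  intro S hS
  rcases S.eq_empty_or_nonempty with rfl | ⟨u, hu⟩
  · simp [h0]
  have hlt : (S.erase u).card < n := hS ▸ Finset.card_erase_lt_of_mem hu
  rw [h S u hu, ← Finset.add_sum_erase _ _ hu]
  simp only [derivative_sub, derivative_mul, derivative_X, derivative_sum]
  rw [ih _ hlt _ rfl]
  have e1 : ∀ v ∈ S.erase u, P (S.erase v) = X * P ((S.erase u).erase v) -
      ∑ y ∈ (S.erase u).filter (adj u), if y = v then 0 else P (((S.erase u).erase y).erase v) := by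
    intro v hv
    have huv := Finset.ne_of_mem_erase hv
    rw [h (S.erase v) u (Finset.mem_erase.2 ⟨huv.symm, hu⟩),
      Finset.erase_right_comm (a := v) (b := u)]
    congr 1
    rw [Finset.sum_filter, Finset.sum_filter, ← Finset.add_sum_erase _ _ hv]
    simp only [if_true, ite_self, zero_add]
    apply Finset.sum_congr rfl
    intro y hy
    rw [if_neg (Finset.ne_of_mem_erase hy), Finset.erase_right_comm (a := v) (b := y)]
  rw [Finset.sum_congr rfl e1, Finset.sum_sub_distrib, ← Finset.mul_sum, Finset.sum_comm]
  have e2 : ∑ y ∈ (S.erase u).filter (adj u), derivative (P ((S.erase u).erase y)) =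
     ∑ y ∈ (S.erase u).filter (adj u), ∑ v ∈ S.erase u,
       if y = v then 0 else P (((S.erase u).erase y).erase v) := by
    apply Finset.sum_congr rfl
    intro y hy
    have hy' := (Finset.mem_filter.1 hy).1
    have hlt2 : ((S.erase u).erase y).card < n :=
      lt_trans (Finset.card_erase_lt_of_mem hy') hlt
    rw [ih _ hlt2 _ rfl, ← Finset.add_sum_erase _ _ hy']
    simp only [if_true, zero_add]
    apply Finset.sum_congr rfl
    intro v hv
    rw [if_neg (Finset.ne_of_mem_erase hv).symm]
  rw [e2]
  ring

/-- multiplicativity -/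
theorem rec_mul (adj : V → V → Prop) [DecidableRel adj]
    (P : Finset V → ℝ[X]) (h : IsRec adj (fun _ => X) P) (h0 : P ∅ = 1) (B : Finset V) :
    ∀ (n : ℕ) (A : Finset V), A.card = n → Disjoint A B → (∀ a ∈ A, ∀ b ∈ B, ¬ adj a b) →
      P (A ∪ B) = P A * P B := by
  intro n
  induction n using Nat.strong_induction_on with
  | _ n ih =>
  intro A hA hd hn
  rcases A.eq_empty_or_nonempty with rfl | ⟨u, hu⟩
  · simp [h0]
  have huB : u ∉ B := Finset.disjoint_left.1 hd hu
  have hlt : (A.erase u).card < n := hA ▸ Finset.card_erase_lt_of_mem hu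
  have hd1 : Disjoint (A.erase u) B := hd.mono_left (Finset.erase_subset _ _)
  have hE : (A ∪ B).erase u = A.erase u ∪ B := by
    rw [Finset.erase_union_distrib, Finset.erase_eq_of_notMem huB]
  rw [h (A ∪ B) u (Finset.mem_union_left _ hu), h A u hu, hE,
    ih _ hlt _ rfl hd1 (fun a ha => hn a (Finset.mem_of_mem_erase ha))]
  have hF : (A.erase u ∪ B).filter (adj u) = (A.erase u).filter (adj u) := by
    ext y
    simp only [Finset.mem_filter, Finset.mem_union]
    constructor
    · rintro ⟨h1 | h1, h2⟩
      · exact ⟨h1, h2⟩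
      · exact absurd h2 (hn u hu y h1)
    · rintro ⟨h1, h2⟩
      exact ⟨Or.inl h1, h2⟩
  rw [hF, sub_mul, Finset.sum_mul, mul_assoc]
  congr 1
  apply Finset.sum_congr rfl
  intro y hy
  have hy' := (Finset.mem_filter.1 hy).1
  have hyB : y ∉ B := Finset.disjoint_left.1 hd1 hy'
  have hlt2 : ((A.erase u).erase y).card < n :=
    lt_trans (Finset.card_erase_lt_of_mem hy') hlt
  rw [Finset.erase_union_distrib, Finset.erase_eq_of_notMem hyB]
  exact ih _ hlt2 _ rfl (hd1.mono_left (Finset.erase_subset _ _))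
    (fun a ha => hn a (Finset.mem_of_mem_erase (Finset.mem_of_mem_erase ha)))

/-- Changing the weight of the vertex `u`. -/
theorem rec_perturb (adj : V → V → Prop) [DecidableRel adj]
    (f : Finset V → ℝ) (x : V → ℝ) (h : IsRec adj x f) (u : V) :
    IsRec adj (fun v => if v = u then x v - 1 else x v)
      (fun S => f S - if u ∈ S then f (S.erase u) else 0) := by
  intro S v hv
  by_cases hvu : v = u
  · subst hvu
    have := h S v hv
    simp [hv]
    linarith
  · simp only [if_neg hvu]
    rw [Finset.sum_sub_distrib]
    by_cases hu : u ∈ S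
    · have h1 := h S v hv
      have h2 := h (S.erase u) v (Finset.mem_erase.2 ⟨hvu, hv⟩)
      have hu' : u ∈ S.erase v := Finset.mem_erase.2 ⟨Ne.symm hvu, hu⟩
      rw [Finset.erase_right_comm (a := u) (b := v)] at h2
      have e : ∑ y ∈ (S.erase v).filter (adj v),
          (if u ∈ (S.erase v).erase y then f (((S.erase v).erase y).erase u) else 0) =
          ∑ y ∈ ((S.erase v).erase u).filter (adj v), f (((S.erase v).erase u).erase y) := by
        rw [Finset.sum_filter, Finset.sum_filter, ← Finset.add_sum_erase _ _ hu']
        simp only [Finset.notMem_erase, if_false, ite_self, zero_add]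
        apply Finset.sum_congr rfl
        intro y hy
        have : u ∈ (S.erase v).erase y :=
          Finset.mem_erase.2 ⟨(Finset.ne_of_mem_erase hy).symm, hu'⟩
        rw [if_pos this, Finset.erase_right_comm (a := y) (b := u)]
      rw [e, if_pos hu, if_pos hu']
      linarith
    · have h1 := h S v hv
      have : ∀ y, u ∉ (S.erase v).erase y := fun y hy =>
        hu (Finset.mem_of_mem_erase (Finset.mem_of_mem_erase hy))
      have h3 : u ∉ S.erase v := fun hy => hu (Finset.mem_of_mem_erase hy)
      simp only [this, hu, h3, if_false, Finset.sum_const_zero]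
      linarith

end Rec

section Poly
open Polynomial

/-- `p` vanishes to order at least `k` at `θ`, with `k`-th coefficient `a`. -/
def Lead (θ : ℝ) (p : ℝ[X]) (k : ℕ) (a : ℝ) : Prop :=
  ∃ r : ℝ[X], p = (X - C θ) ^ k * r ∧ r.eval θ = a

variable {θ : ℝ} {p q : ℝ[X]} {j k : ℕ} {a b : ℝ}

theorem Lead.mul (hp : Lead θ p k a) (hq : Lead θ q j b) : Lead θ (p * q) (k + j) (a * b) := by
  obtain ⟨r, rfl, rfl⟩ := hp
  obtain ⟨s, rfl, rfl⟩ := hq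
  exact ⟨r * s, by ring, by simp⟩

theorem Lead.add (hp : Lead θ p k a) (hq : Lead θ q k b) : Lead θ (p + q) k (a + b) := by
  obtain ⟨r, rfl, rfl⟩ := hp
  obtain ⟨s, rfl, rfl⟩ := hq
  exact ⟨r + s, by ring, by simp⟩

theorem Lead.sub (hp : Lead θ p k a) (hq : Lead θ q k b) : Lead θ (p - q) k (a - b) := by
  obtain ⟨r, rfl, rfl⟩ := hp
  obtain ⟨s, rfl, rfl⟩ := hq
  exact ⟨r - s, by ring, by simp⟩

theorem Lead.lower (hp : Lead θ p k a) (hj : j < k) : Lead θ p j 0 := by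
  obtain ⟨r, rfl, rfl⟩ := hp
  obtain ⟨i, rfl⟩ := Nat.exists_eq_add_of_lt hj
  exact ⟨(X - C θ) ^ (i + 1) * r, by ring, by simp⟩

theorem Lead.lower' (hp : Lead θ p k a) (hj : j ≤ k) : ∃ b, Lead θ p j b := by
  rcases hj.lt_or_eq with h | rfl
  · exact ⟨0, hp.lower h⟩
  · exact ⟨a, hp⟩

theorem eventually_neg (r : ℝ[X]) (h : r.eval θ < 0) :
    ∃ ε > 0, ∀ t, |t - θ| < ε → r.eval t < 0 := by
  have hc := r.continuous.continuousAt (x := θ)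
  have := hc.eventually (gt_mem_nhds h)
  rw [Metric.eventually_nhds_iff] at this
  exact this

theorem Lead.nonneg (hp : Lead θ p k a) (h : ∀ t, 0 ≤ p.eval t) : 0 ≤ a := by
  obtain ⟨r, rfl, rfl⟩ := hp
  by_contra! hlt
  obtain ⟨ε, hε, hr⟩ := eventually_neg r hlt
  have h1 := hr (θ + ε / 2) (by rw [abs_lt]; constructor <;> linarith)
  have h2 := h (θ + ε / 2)
  simp only [eval_mul, eval_pow, eval_sub, eval_X, eval_C] at h2
  have : (0:ℝ) < (θ + ε / 2 - θ) ^ k := by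
    apply pow_pos; linarith
  nlinarith

theorem Lead.odd (hp : Lead θ p k a) (hk : Odd k) (h : ∀ t, 0 ≤ p.eval t) : a = 0 := by
  apply le_antisymm _ (hp.nonneg h)
  obtain ⟨r, rfl, rfl⟩ := hp
  by_contra! hlt
  obtain ⟨ε, hε, hr⟩ := eventually_neg (θ := θ) (-r) (by simpa using hlt)
  have h1 := hr (θ - ε / 2) (by rw [abs_lt]; constructor <;> linarith)
  have h2 := h (θ - ε / 2)
  simp only [eval_mul, eval_pow, eval_sub, eval_X, eval_C, eval_neg] at h1 h2
  have : (θ - ε / 2 - θ) ^ k < 0 := by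
    apply hk.pow_neg; linarith
  nlinarith

theorem lead_exists (hp : p ≠ 0) : ∃ a, a ≠ 0 ∧ Lead θ p (p.rootMultiplicity θ) a := by
  obtain ⟨r, h1, h2⟩ := Polynomial.exists_eq_pow_rootMultiplicity_mul_and_not_dvd p hp θ
  refine ⟨r.eval θ, ?_, r, h1, rfl⟩
  intro h
  exact h2 (Polynomial.dvd_iff_isRoot.2 h)

theorem Lead.le_mult (hp : p ≠ 0) (h : Lead θ p k a) : k ≤ p.rootMultiplicity θ := by
  obtain ⟨r, h1, _⟩ := h
  exact (Polynomial.le_rootMultiplicity_iff hp).2 ⟨r, h1⟩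

theorem lead_of_le (hp : p ≠ 0) (h : k ≤ p.rootMultiplicity θ) : ∃ a, Lead θ p k a := by
  obtain ⟨a, _, ha⟩ := lead_exists (θ := θ) hp
  exact ha.lower' h

theorem lead_of_lt (hp : p ≠ 0) (h : k < p.rootMultiplicity θ) : Lead θ p k 0 := by
  obtain ⟨a, _, ha⟩ := lead_exists (θ := θ) hp
  exact ha.lower h

theorem lead_of_eq (hp : p ≠ 0) (h : p.rootMultiplicity θ = k) : ∃ a, a ≠ 0 ∧ Lead θ p k a := by
  subst h
  exact lead_exists hp

/-- squeeze -/
theorem squeeze (hq0 : q ≠ 0) (hp : Lead θ p (2 * k + 1) a) (h : ∀ t, (q.eval t) ^ 2 ≤ p.eval t) :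
    k + 1 ≤ q.rootMultiplicity θ := by
  by_contra! hlt
  obtain ⟨b, hb, hq⟩ := lead_exists (θ := θ) hq0
  have h1 := (hp.lower (j := q.rootMultiplicity θ + q.rootMultiplicity θ) (by omega)).sub (hq.mul hq)
  have := h1.nonneg (by intro t; have := h t; simp only [eval_sub, eval_mul]; nlinarith)
  nlinarith [mul_self_pos.2 hb]

/-- order of the Wronskian -/
theorem wronskian_lead (hp : Lead θ p k a) (hq : Lead θ q j b) :
    ∃ W : ℝ[X], (X - C θ) * (derivative p * q - p * derivative q) = (X - C θ) ^ (k + j) * W ∧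
      W.eval θ = ((k : ℝ) - j) * (a * b) := by
  obtain ⟨r, rfl, rfl⟩ := hp
  obtain ⟨s, rfl, rfl⟩ := hq
  have hd : ∀ (n : ℕ) (r : ℝ[X]), (X - C θ) * derivative ((X - C θ) ^ n * r) =
      (X - C θ) ^ n * (C (n : ℝ) * r + (X - C θ) * derivative r) := by
    intro n r
    rcases n with _ | n
    · simp
    · simp only [derivative_mul, derivative_pow, derivative_sub, derivative_X, derivative_C]
      simp
      ring
  refine ⟨(C (k : ℝ) * r + (X - C θ) * derivative r) * s -
    r * (C (j : ℝ) * s + (X - C θ) * derivative s), ?_, ?_⟩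
  · have h1 := hd k r
    have h2 := hd j s
    linear_combination ((X - C θ) ^ j * s) * h1 - ((X - C θ) ^ k * r) * h2
  · simp
    ring

theorem wronskian_lead' {n : ℕ} (hp : Lead θ p k a) (hq : Lead θ q j b) (hn : k + j = n + 1) :
    Lead θ (derivative p * q - p * derivative q) n (((k : ℝ) - j) * (a * b)) := by
  obtain ⟨W, h1, h2⟩ := wronskian_lead hp hq
  refine ⟨W, ?_, h2⟩
  rw [hn, pow_succ'] at h1
  have : (X - C θ : ℝ[X]) ≠ 0 := X_sub_C_ne_zero θ
  apply mul_left_cancel₀ this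
  rw [h1]; ring

end Poly
end EssCrit
namespace EssCrit
section Stab
open Polynomial
variable {V : Type*} [DecidableEq V] {adj : V → V → Prop} [DecidableRel adj]
  {P : Finset V → ℝ[X]}

theorem N_nonneg (h : IsRec adj (fun _ => X) P) {S : Finset V} {u v : V} (hu : u ∈ S) (hv : v ∈ S)
    (huv : u ≠ v) (t : ℝ) :
    0 ≤ (P (S.erase u) * P (S.erase v) - P S * P ((S.erase u).erase v)).eval t := by
  have := rec_nonneg adj _ _ (h.eval t) _ S rfl u hu v hv huv
  simp only [eval_sub, eval_mul]
  refine le_trans ?_ this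
  split_ifs <;> positivity

theorem N_edge (h : IsRec adj (fun _ => X) P) {S : Finset V} {u v : V} (hu : u ∈ S) (hv : v ∈ S)
    (huv : u ≠ v) (ha : adj u v) (t : ℝ) :
    (eval t (P ((S.erase u).erase v))) ^ 2 ≤
    (P (S.erase u) * P (S.erase v) - P S * P ((S.erase u).erase v)).eval t := by
  have := rec_nonneg adj _ _ (h.eval t) _ S rfl u hu v hv huv
  simp only [eval_sub, eval_mul]
  rw [if_pos ha] at this
  exact this

theorem wronskian_ge (h : IsRec adj (fun _ => X) P) (h0 : P ∅ = 1) {S : Finset V} {u : V}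
    (hu : u ∈ S) (t : ℝ) :
    (eval t (P (S.erase u))) ^ 2 ≤
      (derivative (P S) * P (S.erase u) - P S * derivative (P (S.erase u))).eval t := by
  have e : derivative (P S) * P (S.erase u) - P S * derivative (P (S.erase u)) =
      P (S.erase u) * P (S.erase u) + ∑ v ∈ S.erase u,
        (P (S.erase u) * P (S.erase v) - P S * P ((S.erase u).erase v)) := by
    rw [rec_deriv adj P h h0 _ _ rfl, rec_deriv adj P h h0 _ _ rfl, ← Finset.add_sum_erase _ _ hu,
      Finset.sum_sub_distrib, ← Finset.mul_sum, ← Finset.mul_sum]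
    ring
  rw [e, eval_add, eval_finsetSum, eval_mul]
  have := Finset.sum_nonneg (s := S.erase u) (fun v hv =>
    N_nonneg h hu (Finset.mem_of_mem_erase hv) (Finset.ne_of_mem_erase hv).symm t)
  nlinarith

theorem P_ne_zero (h : IsRec adj (fun _ => X) P) (h0 : P ∅ = 1) :
    ∀ (n : ℕ) (S : Finset V), S.card = n → P S ≠ 0 := by
  intro n
  induction n with
  | zero =>
    intro S hS
    rw [Finset.card_eq_zero] at hS
    simp [hS, h0]
  | succ n ih =>
    intro S hS h1
    obtain ⟨u, hu⟩ : S.Nonempty := by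
      rw [← Finset.card_pos]; omega
    apply ih (S.erase u) (by rw [Finset.card_erase_of_mem hu, hS]; rfl)
    apply Polynomial.funext
    intro t
    have := wronskian_ge h h0 hu t
    rw [h1] at this
    simp at this
    simpa using this

variable {θ : ℝ}

theorem ord_lower (h : IsRec adj (fun _ => X) P) (h0 : P ∅ = 1) {S : Finset V} {u : V}
    (hu : u ∈ S) :
    (P S).rootMultiplicity θ ≤ (P (S.erase u)).rootMultiplicity θ + 1 := by
  have n1 := P_ne_zero h h0 _ S rfl
  have n2 := P_ne_zero h h0 _ (S.erase u) rfl
  obtain ⟨a, ha, hp⟩ := lead_exists (θ := θ) n1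
  obtain ⟨b, hb, hq⟩ := lead_exists (θ := θ) n2
  by_contra! hlt
  obtain ⟨k, hk⟩ := Nat.exists_eq_add_of_lt hlt
  have hW := wronskian_lead' (n := 2 * (P (S.erase u)).rootMultiplicity θ + 1 + k) hp hq (by omega)
  obtain ⟨c, hc⟩ := hW.lower' (j := 2 * (P (S.erase u)).rootMultiplicity θ + 1) (by omega)
  have := squeeze n2 hc (wronskian_ge h h0 hu)
  omega

theorem ord_upper (h : IsRec adj (fun _ => X) P) (h0 : P ∅ = 1) {S : Finset V} {u : V}
    (hu : u ∈ S) :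
    (P (S.erase u)).rootMultiplicity θ ≤ (P S).rootMultiplicity θ + 1 := by
  have n1 := P_ne_zero h h0 _ S rfl
  have n2 := P_ne_zero h h0 _ (S.erase u) rfl
  rcases Nat.eq_zero_or_pos ((P (S.erase u)).rootMultiplicity θ) with hz | hz
  · omega
  obtain ⟨k, hk⟩ : ∃ k, (P (S.erase u)).rootMultiplicity θ = k + 1 := ⟨_, (Nat.succ_pred_eq_of_pos hz).symm⟩
  rw [hk]
  suffices k ≤ (P S).rootMultiplicity θ by omega
  rw [Polynomial.le_rootMultiplicity_iff n1, h S u hu]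
  apply dvd_sub
  · apply Dvd.dvd.mul_left
    rw [← Polynomial.le_rootMultiplicity_iff n2]; omega
  · apply Finset.dvd_sum
    intro y hy
    rw [← Polynomial.le_rootMultiplicity_iff (P_ne_zero h h0 _ _ rfl)]
    have := ord_lower (θ := θ) h h0 (Finset.mem_filter.1 hy).1
    omega

theorem sign_ess (h : IsRec adj (fun _ => X) P) (h0 : P ∅ = 1) {S : Finset V} {u : V}
    (hu : u ∈ S) {k : ℕ} {a b : ℝ} (ha : a ≠ 0) (hb : b ≠ 0) (hp : Lead θ (P S) (k + 1) a)
    (hq : Lead θ (P (S.erase u)) k b) : 0 < a * b := by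
  have hW := wronskian_lead' (n := k + k) hp hq (by omega)
  have := hW.nonneg (fun t => le_trans (sq_nonneg _) (wronskian_ge h h0 hu t))
  push_cast at this
  have h3 : a * b ≠ 0 := mul_ne_zero ha hb
  apply lt_of_le_of_ne _ h3.symm
  nlinarith

theorem sign_pos (h : IsRec adj (fun _ => X) P) (h0 : P ∅ = 1) {S : Finset V} {u : V}
    (hu : u ∈ S) {k : ℕ} {a b : ℝ} (ha : a ≠ 0) (hb : b ≠ 0) (hp : Lead θ (P S) k a)
    (hq : Lead θ (P (S.erase u)) (k + 1) b) : a * b < 0 := by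
  have hW := wronskian_lead' (n := k + k) hp hq (by omega)
  have := hW.nonneg (fun t => le_trans (sq_nonneg _) (wronskian_ge h h0 hu t))
  push_cast at this
  have h3 : a * b ≠ 0 := mul_ne_zero ha hb
  apply lt_of_le_of_ne _ h3
  nlinarith

/-- A special vertex is positive. -/
theorem special_pos (h : IsRec adj (fun _ => X) P) (h0 : P ∅ = 1) {S : Finset V} {u w : V}
    (hu : u ∈ S) (hw : w ∈ S) (huw : u ≠ w) (hadj : adj u w) {k : ℕ}
    (hS : (P S).rootMultiplicity θ = k + 1) (hSw : (P (S.erase w)).rootMultiplicity θ = k)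
    (hSu : k + 1 ≤ (P (S.erase u)).rootMultiplicity θ) :
    (P (S.erase u)).rootMultiplicity θ = k + 2 := by
  have nz := fun S => P_ne_zero h h0 _ S rfl
  have hw' : w ∈ S.erase u := Finset.mem_erase.2 ⟨huw.symm, hw⟩
  have h1 := ord_lower (θ := θ) h h0 hw'
  have h2 := ord_upper (θ := θ) h h0 hu
  obtain ⟨a, ha, la⟩ := lead_of_eq (nz _) hS
  obtain ⟨b, hb, lb⟩ := lead_of_eq (nz _) hSw
  obtain ⟨c, lc⟩ := lead_of_le (nz _) hSu
  obtain ⟨d, ld⟩ := lead_of_le (θ := θ) (k := k) (nz ((S.erase u).erase w)) (by omega)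
  have lN := (lc.mul lb).sub (la.mul ld)
  have e : k + 1 + k = 2 * k + 1 := by ring
  rw [e] at lN
  have h3 := squeeze (nz _) lN (N_edge h hu hw huw hadj)
  by_contra hne
  have hSu' : (P (S.erase u)).rootMultiplicity θ = k + 1 := by omega
  obtain ⟨c', hc', lc'⟩ := lead_of_eq (nz _) hSu'
  have ld' := lead_of_lt (θ := θ) (k := k) (nz ((S.erase u).erase w)) (by omega)
  have lN' := (lc'.mul lb).sub (la.mul ld')
  have := lN'.odd ⟨k, e⟩ (N_nonneg h hu hw huw)
  apply mul_ne_zero hc' hb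
  linarith

/-- Essential vertices stay essential when a positive vertex is deleted. -/
theorem ess_of_pos (h : IsRec adj (fun _ => X) P) (h0 : P ∅ = 1) {S : Finset V} {u v : V}
    (hu : u ∈ S) (hv : v ∈ S) (huv : u ≠ v) {k : ℕ}
    (hS : (P S).rootMultiplicity θ = k + 1) (hSv : (P (S.erase v)).rootMultiplicity θ = k)
    (hSu : (P (S.erase u)).rootMultiplicity θ = k + 2) :
    (P ((S.erase u).erase v)).rootMultiplicity θ = k + 1 := by
  have nz := fun S => P_ne_zero h h0 _ S rfl
  have hv' : v ∈ S.erase u := Finset.mem_erase.2 ⟨huv.symm, hv⟩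
  have h1 := ord_lower (θ := θ) h h0 hv'
  by_contra hne
  obtain ⟨a, ha, la⟩ := lead_of_eq (nz _) hS
  obtain ⟨b, hb, lb⟩ := lead_of_eq (nz _) hSv
  obtain ⟨c, hc, lc⟩ := lead_of_eq (nz _) hSu
  have ld := lead_of_lt (θ := θ) (k := k + 1) (nz ((S.erase u).erase v)) (by omega)
  have e : k + 2 + k = k + 1 + (k + 1) := by ring
  have l1 := lc.mul lb
  rw [e] at l1
  have h2 := (l1.sub (la.mul ld)).nonneg (N_nonneg h hu hv huv)
  have h3 := sign_ess h h0 hv ha hb la lb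
  have h4 := sign_pos h h0 hu ha hc la lc
  have h5 : 0 < a * a := mul_self_pos.2 ha
  have h6 : (a * b) * (a * c) < 0 := mul_neg_of_pos_of_neg h3 h4
  nlinarith

/-- The main step of the stability lemma. -/
theorem not_ess_of_special (h : IsRec adj (fun _ => X) P) (h0 : P ∅ = 1) {S : Finset V} {u v w : V}
    (hu : u ∈ S) (hv : v ∈ S) (hw : w ∈ S) (huv : u ≠ v) (huw : u ≠ w) (hadj : adj u w) {k : ℕ}
    (hS : (P S).rootMultiplicity θ = k + 1) (hSw : (P (S.erase w)).rootMultiplicity θ = k)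
    (hSu : (P (S.erase u)).rootMultiplicity θ = k + 2)
    (hSv : k + 1 ≤ (P (S.erase v)).rootMultiplicity θ)
    (hSuv : (P ((S.erase u).erase v)).rootMultiplicity θ = k + 1) : False := by
  have nz := fun S => P_ne_zero h h0 _ S rfl
  have hvw : v ≠ w := by rintro rfl; omega
  have cuv : (S.erase v).erase u = (S.erase u).erase v := Finset.erase_right_comm
  have cvw : (S.erase w).erase v = (S.erase v).erase w := Finset.erase_right_comm
  have cuw : (S.erase w).erase u = (S.erase u).erase w := Finset.erase_right_comm
  have hwv : w ∈ S.erase v := Finset.mem_erase.2 ⟨hvw.symm, hw⟩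
  have huv' : u ∈ S.erase v := Finset.mem_erase.2 ⟨huv, hu⟩
  have hvu' : v ∈ S.erase u := Finset.mem_erase.2 ⟨huv.symm, hv⟩
  have hwu' : w ∈ S.erase u := Finset.mem_erase.2 ⟨huw.symm, hw⟩
  have h1 := ord_upper (θ := θ) h h0 hv
  have h2 := ord_lower (θ := θ) h h0 hwv
  obtain ⟨a, ha, la⟩ := lead_of_eq (nz _) hS
  obtain ⟨b, hb, lb⟩ := lead_of_eq (nz _) hSw
  obtain ⟨c, hc, lc⟩ := lead_of_eq (nz _) hSu
  obtain ⟨d, hd, ld⟩ := lead_of_eq (nz _) hSuv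
  rcases hSv.eq_or_lt with hSv | hSv
  · -- the neutral case
    have hSvw : (P ((S.erase v).erase w)).rootMultiplicity θ = k := by
      by_contra hne
      obtain ⟨x, hx, lx⟩ := lead_of_eq (nz _) hSv.symm
      have ly := lead_of_lt (θ := θ) (k := k) (nz ((S.erase v).erase w)) (by omega)
      have := ((lx.mul lb).sub (la.mul ly)).odd ⟨k, by ring⟩ (N_nonneg h hv hw hvw)
      apply mul_ne_zero hx hb
      linarith
    have := special_pos h h0 huv' hwv huw hadj hSv.symm hSvw (by rw [cuv]; omega)
    rw [cuv] at this
    omega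
  · have hSv : (P (S.erase v)).rootMultiplicity θ = k + 2 := by omega
    have hSuw := ess_of_pos h h0 hu hw huw hS hSw hSu
    have hSvw := ess_of_pos h h0 hv hw hvw hS hSw hSv
    have hwuv : w ∈ (S.erase u).erase v := Finset.mem_erase.2 ⟨hvw.symm, hwu'⟩
    have h3 := ord_lower (θ := θ) h h0 hwuv
    obtain ⟨x, hx, lx⟩ := lead_of_eq (nz _) hSv
    obtain ⟨y, hy, ly⟩ := lead_of_eq (nz _) hSuw
    obtain ⟨z, hz, lz⟩ := lead_of_eq (nz _) hSvw
    obtain ⟨s, ls⟩ := lead_of_le (θ := θ) (k := k) (nz (((S.erase u).erase v).erase w)) (by omega)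
    have huvw : k + 1 ≤ (P (((S.erase u).erase v).erase w)).rootMultiplicity θ := by
      have l1 := ((ld.mul lz).lower (j := 2 * k + 1) (by omega)).sub
        ((lx.mul ls).lower (j := 2 * k + 1) (by omega))
      rw [← cuv] at l1 ⊢
      exact squeeze (nz _) l1 (N_edge h huv' hwv huw hadj)
    obtain ⟨s, ls⟩ := lead_of_le (θ := θ) (k := k + 1) (nz (((S.erase u).erase v).erase w)) huvw
    have cu1 : ((S.erase v).erase w).erase u = ((S.erase u).erase v).erase w := by
      rw [Finset.erase_right_comm (a := w) (b := u), cuv]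
    let Q : ℝ[X] := (P (S.erase v) - P ((S.erase u).erase v)) *
      (P (S.erase w) - P ((S.erase u).erase w)) -
      (P S - P (S.erase u)) * (P ((S.erase v).erase w) - P (((S.erase u).erase v).erase w))
    have hQ : ∀ t, 0 ≤ Q.eval t := by
      intro t
      have := rec_nonneg adj _ _ (rec_perturb adj _ _ (h.eval t) u) _ S rfl v hv w hw hvw
      have m1 : u ∈ S.erase w := Finset.mem_erase.2 ⟨huw, hu⟩
      have m2 : u ∈ (S.erase v).erase w := Finset.mem_erase.2 ⟨huw, huv'⟩
      simp only [if_pos hu, if_pos huv', if_pos m1, if_pos m2, cuv, cuw, cu1] at this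
      simp only [Q, eval_sub, eval_mul]
      refine le_trans ?_ this
      split_ifs <;> positivity
    -- leading terms at order `2 * k + 1`
    have lQ := (((lx.lower (j := k + 1) (by omega)).sub ld).mul
      (lb.sub (ly.lower (j := k) (by omega)))).sub
      ((la.sub (lc.lower (j := k + 1) (by omega))).mul
        ((lz.lower (j := k) (by omega)).sub (ls.lower (j := k) (by omega))))
    have := lQ.odd ⟨k, by ring⟩ hQ
    apply mul_ne_zero hd hb
    linarith

/-- essential vertices of `S` -/
def Ess (θ : ℝ) (P : Finset V → ℝ[X]) (S : Finset V) (v : V) : Prop :=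
  v ∈ S ∧ (P (S.erase v)).rootMultiplicity θ + 1 = (P S).rootMultiplicity θ

theorem stability (h : IsRec adj (fun _ => X) P) (h0 : P ∅ = 1) {S : Finset V} {u w : V}
    (hu : u ∈ S) (huw : u ≠ w) (hadj : adj u w) (hnu : ¬ Ess θ P S u) (hw : Ess θ P S w) (v : V) :
    Ess θ P (S.erase u) v ↔ Ess θ P S v := by
  obtain ⟨hwS, hw⟩ := hw
  obtain ⟨k, hk⟩ : ∃ k, (P (S.erase w)).rootMultiplicity θ = k := ⟨_, rfl⟩
  rw [hk] at hw
  have hu2 : (P (S.erase u)).rootMultiplicity θ + 1 ≠ (P S).rootMultiplicity θ :=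
    fun h => hnu ⟨hu, h⟩
  have h1 := ord_lower (θ := θ) h h0 hu
  have hSu := special_pos h h0 hu hwS huw hadj hw.symm hk (by omega)
  by_cases hvS : v ∈ S
  · by_cases hvu : v = u
    · subst hvu
      exact ⟨fun h => absurd h.1 (Finset.notMem_erase _ _), fun h => absurd h hnu⟩
    · have hvS' : v ∈ S.erase u := Finset.mem_erase.2 ⟨hvu, hvS⟩
      have h2 := ord_lower (θ := θ) h h0 hvS
      simp only [Ess, hvS, hvS', true_and]
      constructor
      · intro h3
        by_contra h4
        exact not_ess_of_special h h0 hu hvS hwS (Ne.symm hvu) huw hadj hw.symm hk hSu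
          (by omega) (by omega)
      · intro h3
        have := ess_of_pos h h0 hu hvS (Ne.symm hvu) hw.symm (by omega) hSu
        omega
  · simp [Ess, hvS]

/-- Deleting all special vertices. -/
theorem exists_reduced (h : IsRec adj (fun _ => X) P) (h0 : P ∅ = 1) (hirr : ∀ u, ¬ adj u u) :
    ∀ (n : ℕ) (S : Finset V), S.card = n → ∃ S' ⊆ S, (∀ v, Ess θ P S' v ↔ Ess θ P S v) ∧
      ∀ u ∈ S', ∀ w, adj u w → Ess θ P S' w → Ess θ P S' u := by
  intro n
  induction n with
  | zero =>
    intro S hS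
    rw [Finset.card_eq_zero] at hS
    subst hS
    exact ⟨∅, by simp, by simp, by simp⟩
  | succ n ih =>
    intro S hS
    by_cases hall : ∀ u ∈ S, ∀ w, adj u w → Ess θ P S w → Ess θ P S u
    · exact ⟨S, subset_rfl, fun _ => Iff.rfl, hall⟩
    · push Not at hall
      obtain ⟨u, hu, w, hadj, hw, hnu⟩ := hall
      have huw : u ≠ w := by rintro rfl; exact hirr _ hadj
      have hst := stability h h0 hu huw hadj hnu hw
      obtain ⟨S', hS', h1, h2⟩ := ih (S.erase u) (by rw [Finset.card_erase_of_mem hu, hS]; rfl)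
      exact ⟨S', hS'.trans (Finset.erase_subset _ _), fun v => (h1 v).trans (hst v), h2⟩

theorem component_critical (h : IsRec adj (fun _ => X) P) (h0 : P ∅ = 1) (hirr : ∀ u, ¬ adj u u)
    (hsymm : ∀ u v, adj u v → adj v u)
    (S Cc : Finset V) (hC : ∀ v ∈ Cc, Ess θ P S v)
    (hcl : ∀ v ∈ Cc, ∀ w, Ess θ P S w → adj v w → w ∈ Cc) (u : V) (hu : u ∈ Cc) :
    Ess θ P Cc u := by
  obtain ⟨S', _, h1, h2⟩ := exists_reduced (θ := θ) h h0 hirr _ S rfl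
  have nz := fun S => P_ne_zero h h0 _ S rfl
  have hsub : Cc ⊆ S' := fun v hv => ((h1 v).2 (hC v hv)).1
  have hno : ∀ a ∈ Cc, ∀ b ∈ S' \ Cc, ¬ adj a b := by
    intro a ha b hb hab
    rw [Finset.mem_sdiff] at hb
    have hb' := h2 b hb.1 a (hsymm _ _ hab) ((h1 a).2 (hC a ha))
    exact hb.2 (hcl a ha b ((h1 b).1 hb') hab)
  have hd : Disjoint Cc (S' \ Cc) := Finset.disjoint_sdiff
  have m1 := rec_mul adj P h h0 _ _ Cc rfl hd hno
  have m2 := rec_mul adj P h h0 _ _ (Cc.erase u) rfl (hd.mono_left (Finset.erase_subset _ _))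
    (fun a ha => hno a (Finset.mem_of_mem_erase ha))
  have hE : Cc.erase u ∪ S' \ Cc = S'.erase u := by
    ext y
    simp only [Finset.mem_union, Finset.mem_erase, Finset.mem_sdiff]
    constructor
    · rintro (⟨h3, h4⟩ | ⟨h3, h4⟩)
      · exact ⟨h3, hsub h4⟩
      · exact ⟨fun h5 => h4 (h5 ▸ hu), h3⟩
    · rintro ⟨h3, h4⟩
      by_cases h5 : y ∈ Cc
      · exact Or.inl ⟨h3, h5⟩
      · exact Or.inr ⟨h4, h5⟩
  rw [Finset.union_sdiff_of_subset hsub] at m1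
  rw [hE] at m2
  have h3 := ((h1 u).2 (hC u hu)).2
  rw [m1, m2, Polynomial.rootMultiplicity_mul (mul_ne_zero (nz _) (nz _)),
    Polynomial.rootMultiplicity_mul (mul_ne_zero (nz _) (nz _))] at h3
  exact ⟨hu, by omega⟩

end Stab
end EssCrit
namespace EssCrit
section Graph
open Polynomial
open scoped Classical
variable {V : Type*} [Fintype V]

/-- `M` is a matching of `G` with all vertices in `S`. -/
def IsM (G : SimpleGraph V) (S : Finset V) (M : Finset (Sym2 V)) : Prop :=
  (∀ e ∈ M, e ∈ G.edgeSet) ∧ (∀ e ∈ M, ∀ f ∈ M, e ≠ f → ∀ v, v ∈ e → v ∉ f) ∧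
    ∀ e ∈ M, ∀ v ∈ e, v ∈ S

/-- vertices of `S` not covered by `M` -/
noncomputable def unc (S : Finset V) (M : Finset (Sym2 V)) : Finset V :=
  S.filter (fun v => ∀ e ∈ M, v ∉ e)

/-- matching polynomial of the subgraph induced on `S` -/
noncomputable def MP (G : SimpleGraph V) (S : Finset V) : ℝ[X] :=
  ∑ M ∈ Finset.univ.filter (fun M => IsM G S M), (-1 : ℝ[X]) ^ M.card * X ^ (unc S M).card

theorem MP_empty (G : SimpleGraph V) : MP G ∅ = 1 := by
  have : Finset.univ.filter (fun M => IsM G ∅ M) = {∅} := by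
    ext M
    simp only [Finset.mem_filter, Finset.mem_univ, true_and, Finset.mem_singleton]
    constructor
    · rintro ⟨_, _, h⟩
      by_contra hne
      obtain ⟨e, he⟩ := Finset.nonempty_iff_ne_empty.2 hne
      induction e using Sym2.ind with
      | _ a b => simpa using h _ he a (by simp)
    · rintro rfl
      simp [IsM]
  simp [MP, this, unc]

theorem MP_rec (G : SimpleGraph V) : IsRec G.Adj (fun _ => X) (MP G) := by
  intro S u hu
  rw [MP, ← Finset.sum_filter_add_sum_filter_not _ (fun M => ∀ e ∈ M, u ∉ e), sub_eq_add_neg]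
  congr 1
  · rw [MP, Finset.mul_sum]
    have : (Finset.univ.filter (fun M => IsM G S M)).filter (fun M => ∀ e ∈ M, u ∉ e) =
        Finset.univ.filter (fun M => IsM G (S.erase u) M) := by
      ext M
      simp only [Finset.mem_filter, Finset.mem_univ, true_and]
      simp only [IsM, Finset.mem_erase]
      constructor
      · rintro ⟨⟨h1, h2, h3⟩, h4⟩
        exact ⟨h1, h2, fun e he v hv => ⟨fun h => h4 e he (h ▸ hv), h3 e he v hv⟩⟩
      · rintro ⟨h1, h2, h3⟩
        exact ⟨⟨h1, h2, fun e he v hv => (h3 e he v hv).2⟩, fun e he hv => (h3 e he u hv).1 rfl⟩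
    rw [this]
    apply Finset.sum_congr rfl
    intro M hM
    simp only [Finset.mem_filter, Finset.mem_univ, true_and] at hM
    have hc : unc S M = insert u (unc (S.erase u) M) := by
      ext v
      simp only [unc, Finset.mem_filter, Finset.mem_insert, Finset.mem_erase]
      constructor
      · rintro ⟨h1, h2⟩
        by_cases hv : v = u
        · exact Or.inl hv
        · exact Or.inr ⟨⟨hv, h1⟩, h2⟩
      · rintro (rfl | ⟨⟨h1, h2⟩, h3⟩)
        · exact ⟨hu, fun e he hv => Finset.notMem_erase _ _ (hM.2.2 e he _ hv)⟩
        · exact ⟨h2, h3⟩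
    rw [hc, Finset.card_insert_of_notMem (by simp [unc])]
    ring
  · simp only [MP]
    rw [← Finset.sum_neg_distrib]
    simp only [← Finset.sum_neg_distrib]
    rw [Finset.sum_sigma']
    symm
    apply Finset.sum_bij (fun (a : Σ _ : V, Finset (Sym2 V)) _ => insert s(u, a.1) a.2)
    · rintro ⟨y, M⟩ hM
      simp only [Finset.mem_sigma, Finset.mem_filter, Finset.mem_univ, true_and,
        Finset.mem_erase] at hM ⊢
      simp only [IsM, Finset.mem_erase] at hM ⊢
      obtain ⟨⟨⟨hyu, hyS⟩, hadj⟩, h1, h2, h3⟩ := hM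
      refine ⟨⟨?_, ?_, ?_⟩, ?_⟩
      · intro e he
        rcases Finset.mem_insert.1 he with rfl | he
        · exact hadj
        · exact h1 e he
      · have hx : ∀ e ∈ M, ∀ v, v ∈ s(u, y) → v ∉ e := by
          intro e he v hv hve
          rcases Sym2.mem_iff.1 hv with rfl | rfl
          · exact (h3 e he _ hve).2.1 rfl
          · exact (h3 e he _ hve).1 rfl
        intro e he f hf hef v hve
        rcases Finset.mem_insert.1 he with rfl | he <;> rcases Finset.mem_insert.1 hf with rfl | hf
        · exact absurd rfl hef
        · exact hx f hf v hve
        · exact fun hvf => hx e he v hvf hve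
        · exact h2 e he f hf hef v hve
      · intro e he v hv
        rcases Finset.mem_insert.1 he with rfl | he
        · rcases Sym2.mem_iff.1 hv with rfl | rfl
          · exact hu
          · exact hyS
        · exact (h3 e he v hv).2.2
      · intro h
        exact h _ (Finset.mem_insert_self _ _) (by simp)
    · rintro ⟨y, M⟩ hM ⟨z, N⟩ hN heq
      simp only [Finset.mem_sigma, Finset.mem_filter, Finset.mem_univ, true_and,
        Finset.mem_erase] at hM hN heq
      simp only [IsM, Finset.mem_erase] at hM hN
      have hm : ∀ y, s(u, y) ∉ M := fun y h => (hM.2.2.2 _ h u (by simp)).2.1 rfl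
      have hn : ∀ y, s(u, y) ∉ N := fun y h => (hN.2.2.2 _ h u (by simp)).2.1 rfl
      have h1 : s(u, y) ∈ insert s(u, z) N := heq ▸ Finset.mem_insert_self _ _
      rcases Finset.mem_insert.1 h1 with h1 | h1
      · have hyz : y = z := Sym2.congr_right.1 h1
        subst hyz
        have : M = N := by
          rw [← Finset.erase_insert (hm y), heq, Finset.erase_insert (hn y)]
        rw [this]
      · exact absurd h1 (hn y)
    · intro M hM
      simp only [Finset.mem_filter, Finset.mem_univ, true_and] at hM
      obtain ⟨⟨h1, h2, h3⟩, h4⟩ := hM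
      push Not at h4
      obtain ⟨e, he, hue⟩ := h4
      obtain ⟨y, rfl⟩ := Sym2.mem_iff_exists.1 hue
      have hadj : G.Adj u y := h1 _ he
      refine ⟨⟨y, M.erase s(u, y)⟩, ?_, Finset.insert_erase he⟩
      simp only [Finset.mem_sigma, Finset.mem_filter, Finset.mem_univ, true_and,
        Finset.mem_erase]
      simp only [IsM, Finset.mem_erase]
      refine ⟨⟨⟨hadj.ne', h3 _ he y (by simp)⟩, hadj⟩, fun e he => h1 e he.2,
        fun e he f hf => h2 e he.2 f hf.2, fun f hf v hv => ⟨?_, ?_, h3 f hf.2 v hv⟩⟩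
      · rintro rfl
        exact h2 f hf.2 _ he hf.1 v hv (by simp)
      · rintro rfl
        exact h2 f hf.2 _ he hf.1 v hv (by simp)
    · rintro ⟨y, M⟩ hM
      simp only [Finset.mem_sigma, Finset.mem_filter, Finset.mem_univ, true_and,
        Finset.mem_erase] at hM ⊢
      simp only [IsM, Finset.mem_erase] at hM ⊢
      have hm : s(u, y) ∉ M := fun h => (hM.2.2.2 _ h u (by simp)).2.1 rfl
      have hc : unc S (insert s(u, y) M) = unc ((S.erase u).erase y) M := by
        ext v
        simp only [unc, Finset.mem_filter, Finset.mem_insert, Finset.mem_erase, forall_eq_or_imp,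
          Sym2.mem_iff]
        tauto
      rw [hc, Finset.card_insert_of_notMem hm]
      ring

theorem card_unc (G : SimpleGraph V) (S : Finset V) (M : Finset (Sym2 V)) (hM : IsM G S M) :
    (unc S M).card = S.card - 2 * M.card := by
  have h1 : unc S M = S \ M.biUnion (fun e => e.toFinset) := by
    ext v
    simp [unc]
  have h2 : (M.biUnion (fun e => e.toFinset)).card = 2 * M.card := by
    rw [Finset.card_biUnion]
    · rw [Finset.sum_congr rfl (fun e he => Sym2.card_toFinset_of_not_isDiag e
        (G.not_isDiag_of_mem_edgeSet (hM.1 e he)))]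
      simp [mul_comm]
    · intro e he f hf hef
      refine Finset.disjoint_left.2 ?_
      intro v hv hv'
      rw [Sym2.mem_toFinset] at hv hv'
      exact hM.2.1 e he f hf hef v hv hv'
  rw [h1, Finset.card_sdiff_of_subset, h2]
  intro v hv
  rw [Finset.mem_biUnion] at hv
  obtain ⟨e, he, hv⟩ := hv
  exact hM.2.2 e he v (Sym2.mem_toFinset.1 hv)

theorem mp_eq {W : Type*} [Finite W] (H : SimpleGraph W) (G : SimpleGraph V) (φ : W → V)
    (hφ : Function.Injective φ) (hadj : ∀ a b, H.Adj a b ↔ G.Adj (φ a) (φ b))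
    (S : Finset V) (hS : ∀ v, v ∈ S ↔ ∃ w, φ w = v) :
    matchingPolynomial H = MP G S := by
  have hφ2 : Function.Injective (Sym2.map φ) := Sym2.map.injective hφ
  have hcard : Nat.card W = S.card := by
    let _ := Fintype.ofFinite W
    rw [Nat.card_eq_fintype_card, ← Finset.card_univ, ← Finset.card_image_of_injective _ hφ]
    congr 1
    ext v
    simp [hS]
  have hedge : ∀ e : Sym2 W, Sym2.map φ e ∈ G.edgeSet ↔ e ∈ H.edgeSet := by
    intro e
    induction e using Sym2.ind with
    | _ a b => simp [hadj]
  have hmem : ∀ (e : Sym2 W) v, φ v ∈ Sym2.map φ e ↔ v ∈ e := by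
    intro e v
    rw [Sym2.mem_map]
    constructor
    · rintro ⟨a, ha, hav⟩
      exact hφ hav ▸ ha
    · exact fun h => ⟨v, h, rfl⟩
  unfold matchingPolynomial MP
  apply Finset.sum_bij (fun M _ => M.image (Sym2.map φ))
  · intro M hM
    simp only [Finset.mem_filter, Finset.mem_univ, true_and] at hM ⊢
    obtain ⟨h1, h2⟩ := hM
    refine ⟨?_, ?_, ?_⟩
    · intro e he
      obtain ⟨e, hme, rfl⟩ := Finset.mem_image.1 he
      exact (hedge e).2 (h1 e hme)
    · intro e he f hf hef v hv hvf
      obtain ⟨e, hme, rfl⟩ := Finset.mem_image.1 he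
      obtain ⟨f, hmf, rfl⟩ := Finset.mem_image.1 hf
      obtain ⟨v, hmv, rfl⟩ := Sym2.mem_map.1 hv
      exact h2 e hme f hmf (fun h => hef (by rw [h])) v hmv ((hmem f v).1 hvf)
    · intro e he v hv
      obtain ⟨e, hme, rfl⟩ := Finset.mem_image.1 he
      obtain ⟨v, hmv, rfl⟩ := Sym2.mem_map.1 hv
      exact (hS _).2 ⟨v, rfl⟩
  · intro M _ N _ heq
    exact Finset.image_injective hφ2 heq
  · intro N hN
    simp only [Finset.mem_filter, Finset.mem_univ, true_and] at hN
    obtain ⟨h1, h2, h3⟩ := hN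
    let _ := Fintype.ofFinite W
    refine ⟨Finset.univ.filter (fun e => Sym2.map φ e ∈ N), ?_, ?_⟩
    · simp only [Finset.mem_filter, Finset.mem_univ, true_and]
      refine ⟨fun e he => (hedge e).1 (h1 _ he), fun e he f hf hef v hv hvf => ?_⟩
      exact h2 _ he _ hf (fun h => hef (hφ2 h)) (φ v) ((hmem e v).2 hv) ((hmem f v).2 hvf)
    · ext e
      simp only [Finset.mem_image, Finset.mem_filter, Finset.mem_univ, true_and]
      constructor
      · rintro ⟨e, he, rfl⟩
        exact he
      · intro he
        revert he
        induction e using Sym2.ind with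
        | _ a b =>
          intro he
          obtain ⟨a, rfl⟩ := (hS a).1 (h3 _ he a (by simp))
          obtain ⟨b, rfl⟩ := (hS b).1 (h3 _ he b (by simp))
          exact ⟨s(a, b), he, rfl⟩
  · intro M hM
    simp only [Finset.mem_filter, Finset.mem_univ, true_and] at hM
    have hI : IsM G S (M.image (Sym2.map φ)) := by
      obtain ⟨h1, h2⟩ := hM
      refine ⟨?_, ?_, ?_⟩
      · intro e he
        obtain ⟨e, hme, rfl⟩ := Finset.mem_image.1 he
        exact (hedge e).2 (h1 e hme)
      · intro e he f hf hef v hv hvf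
        obtain ⟨e, hme, rfl⟩ := Finset.mem_image.1 he
        obtain ⟨f, hmf, rfl⟩ := Finset.mem_image.1 hf
        obtain ⟨v, hmv, rfl⟩ := Sym2.mem_map.1 hv
        exact h2 e hme f hmf (fun h => hef (by rw [h])) v hmv ((hmem f v).1 hvf)
      · intro e he v hv
        obtain ⟨e, hme, rfl⟩ := Finset.mem_image.1 he
        obtain ⟨v, hmv, rfl⟩ := Sym2.mem_map.1 hv
        exact (hS _).2 ⟨v, rfl⟩
    rw [card_unc G S _ hI, Finset.card_image_of_injective _ hφ2, hcard]

theorem ess_iff {W : Type*} [Finite W] (θ : ℝ) (H : SimpleGraph W) (G : SimpleGraph V) (φ : W → V)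
    (hφ : Function.Injective φ) (hadj : ∀ a b, H.Adj a b ↔ G.Adj (φ a) (φ b))
    (S : Finset V) (hS : ∀ v, v ∈ S ↔ ∃ w, φ w = v) (u : W) :
    IsEssential θ H u ↔ Ess θ (MP G) S (φ u) := by
  have h1 := mp_eq H G φ hφ hadj S hS
  have h2 := mp_eq (H.induce {v | v ≠ u}) G (fun v => φ v.1)
    (fun a b h => Subtype.ext (hφ h)) (fun a b => by simp [hadj]) (S.erase (φ u)) (by
      intro v
      rw [Finset.mem_erase, hS]
      constructor
      · rintro ⟨h3, w, rfl⟩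
        exact ⟨⟨w, fun h => h3 (by rw [h])⟩, rfl⟩
      · rintro ⟨⟨w, hw⟩, rfl⟩
        exact ⟨fun h => hw (hφ h), w, rfl⟩)
  unfold IsEssential Ess matchMult
  rw [h1, h2]
  have : φ u ∈ S := (hS _).2 ⟨u, rfl⟩
  simp [this]

end Graph
end EssCrit

-- statement 2
theorem essential_components_are_critical {V : Type*} [Finite V] (θ : ℝ) (G : SimpleGraph V)
    (c : (G.induce {v | IsEssential θ G v}).ConnectedComponent) (u : c.supp) :
    IsEssential θ ((G.induce {v | IsEssential θ G v}).induce c.supp) u := by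
  classical
  let _ := Fintype.ofFinite V
  have hE : ∀ v, IsEssential θ G v ↔ EssCrit.Ess θ (EssCrit.MP G) Finset.univ v := fun v =>
    EssCrit.ess_iff θ G G id Function.injective_id (fun _ _ => Iff.rfl) Finset.univ (by simp) v
  let Cc : Finset V := Finset.univ.filter (fun v => ∃ w : c.supp, w.1.1 = v)
  rw [EssCrit.ess_iff θ _ G (fun v => v.1.1) (fun a b h => Subtype.ext (Subtype.ext h))
    (fun a b => Iff.rfl) Cc (by simp [Cc]) u]
  refine EssCrit.component_critical (adj := G.Adj) (by convert EssCrit.MP_rec G)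
    (EssCrit.MP_empty G) (fun v => G.irrefl) (fun a b h => h.symm) Finset.univ Cc ?_ ?_ u.1.1
    (by simp [Cc])
  · intro v hv
    simp only [Cc, Finset.mem_filter, Finset.mem_univ, true_and] at hv
    obtain ⟨w, rfl⟩ := hv
    exact (hE _).1 w.1.2
  · intro v hv w hw hadj
    simp only [Cc, Finset.mem_filter, Finset.mem_univ, true_and] at hv ⊢
    obtain ⟨v, rfl⟩ := hv
    refine ⟨⟨⟨w, (hE w).2 hw⟩, ?_⟩, rfl⟩
    exact c.mem_supp_of_adj_mem_supp v.2 (by exact hadj)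
end
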